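/- arXiv:2506.13979 — 12 statements merged into one kernel-verified Lean document; each statement's English description precedes it below -/
import Mathlib

section
/- Let n ≥ 1 and let K_n be the complete graph on n vertices. Every proper arc-colouring of type I of the complete symmetric digraph ↔K_n is distinguishing; that is, if c is a proper arc-colouring of type I of ↔K_n and φ is a permutation of the vertices satisfying c(φ(u),φ(v)) = c(u,v) for all u ≠ v, then φ is the identity. -/
/-- A type-I proper arc-colouring of the symmetric digraph of `G`:
no monochromatic 2-cycle and no monochromatic 2-path. -/
def IsTypeIColouring {V : Type*} (G : SimpleGraph V) {k : ℕ} (c : V → V → Fin k) : Prop :=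
  ∀ u v w : V, G.Adj u v → G.Adj v w → c u v ≠ c v w

/-- An arc-colouring of the symmetric digraph of `G` with no monochromatic 2-path. -/
def NoMono2Path {V : Type*} (G : SimpleGraph V) {k : ℕ} (c : V → V → Fin k) : Prop :=
  ∀ u v w : V, G.Adj u v → G.Adj v w → w ≠ u → c u v ≠ c v w

/-- An arc-colouring is distinguishing if the identity is the only automorphism
of `G` preserving it. -/
def IsDistinguishing {V : Type*} (G : SimpleGraph V) {k : ℕ} (c : V → V → Fin k) : Prop :=
  ∀ φ : G ≃g G, (∀ u v : V, G.Adj u v → c (φ u) (φ v) = c u v) → ∀ x : V, φ x = x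

theorem stmt0 (n k : ℕ) (hn : 1 ≤ n) (c : Fin n → Fin n → Fin k)
    (hc : IsTypeIColouring (⊤ : SimpleGraph (Fin n)) c)
    (φ : Equiv.Perm (Fin n))
    (hφ : ∀ u v : Fin n, u ≠ v → c (φ u) (φ v) = c u v) :
    φ = Equiv.refl (Fin n) := by
  ext1 x
  by_contra h
  have hx : x ≠ φ x := fun e => h e.symm
  have hφx : φ x ≠ φ (φ x) := fun e => hx (φ.injective e)
  exact hc x (φ x) (φ (φ x)) hx hφx (hφ x (φ x) hx).symm
end

section
/- For every n ≥ 2, the distinguishing chromatic index of type I of the complete symmetric digraph ↔K_n equals min{k : n ≤ C(k, ⌊k/2⌋)}; that is, the least k such that ↔K_n admits a distinguishing proper arc-colouring of type I with k colours is the least k with n ≤ C(k, ⌊k/2⌋). -/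
/-- On a complete graph every type-I proper arc-colouring is distinguishing. -/
theorem IsTypeIColouring.isDistinguishing_top {V : Type*} {k : ℕ} {c : V → V → Fin k}
    (hc : IsTypeIColouring (⊤ : SimpleGraph V) c) :
    IsDistinguishing (⊤ : SimpleGraph V) c := by
  intro φ hφ x
  by_contra hx
  have hadj : (⊤ : SimpleGraph V).Adj x (φ x) := fun h => hx h.symm
  exact hc x (φ x) (φ (φ x)) hadj (φ.map_adj_iff.mpr hadj) (hφ x (φ x) hadj).symm

/-- Sperner bound: the sets of colours leaving the vertices form an antichain. -/
theorem IsTypeIColouring.le_choose {n k : ℕ} {c : Fin n → Fin n → Fin k}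
    (hc : IsTypeIColouring (⊤ : SimpleGraph (Fin n)) c) :
    n ≤ k.choose (k / 2) := by
  classical
  let A : Fin n → Finset (Fin k) := fun u => {a | ∃ v, u ≠ v ∧ c u v = a}
  have hA : ∀ u v, A u ⊆ A v → u = v := by
    intro u v hsub
    by_contra huv
    have hmem : c u v ∈ A v := hsub (by simpa [A] using ⟨v, huv, rfl⟩)
    obtain ⟨w, hvw, hw⟩ : ∃ w, v ≠ w ∧ c v w = c u v := by simpa [A] using hmem
    exact hc u v w huv hvw hw.symm
  have hinj : Function.Injective A := fun u v h => hA u v h.subset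
  have hanti : IsAntichain (· ⊆ ·)
      (SetLike.coe (Finset.univ.image A) : Set (Finset (Fin k))) := by
    intro s hs t ht hst hsub
    obtain ⟨u, rfl⟩ : ∃ u, A u = s := by simpa using hs
    obtain ⟨v, rfl⟩ : ∃ v, A v = t := by simpa using ht
    exact hst (congrArg A (hA u v hsub))
  simpa [Finset.card_image_of_injective _ hinj] using hanti.sperner

/-- Distinct `k / 2`-subsets of the colour set, one per vertex, yield a type-I proper
arc-colouring of the complete symmetric digraph. -/
theorem exists_isTypeIColouring_top {n k : ℕ} (hn : 2 ≤ n) (hk : n ≤ k.choose (k / 2)) :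
    ∃ c : Fin n → Fin n → Fin k, IsTypeIColouring (⊤ : SimpleGraph (Fin n)) c := by
  have : NeZero k := ⟨by rintro rfl; simp at hk; omega⟩
  obtain ⟨A⟩ : Nonempty (Fin n ↪ Finset.powersetCard (k / 2) (Finset.univ : Finset (Fin k))) :=
    Function.Embedding.nonempty_of_card_le (by simpa using hk)
  have hex : ∀ u v, ∃ a : Fin k, u ≠ v → a ∈ (A u).1 ∧ a ∉ (A v).1 := by
    intro u v
    by_cases huv : u = v
    · exact ⟨0, fun h => absurd huv h⟩
    · have hcard : ∀ w, (A w).1.card = k / 2 := fun w => (Finset.mem_powersetCard.mp (A w).2).2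
      have hsub : ¬ (A u).1 ⊆ (A v).1 := fun h => huv <| A.injective <| Subtype.ext <|
        Finset.eq_of_subset_of_card_le h (by rw [hcard, hcard])
      obtain ⟨a, hu, hv⟩ := Finset.not_subset.mp hsub
      exact ⟨a, fun _ => ⟨hu, hv⟩⟩
  choose c hc using hex
  refine ⟨c, fun u v w huv hvw heq => (hc u v huv).2 ?_⟩
  rw [heq]
  exact (hc v w hvw).1

theorem stmt1 (n : ℕ) (hn : 2 ≤ n) :
    sInf {k : ℕ | ∃ c : Fin n → Fin n → Fin k,
        IsTypeIColouring (⊤ : SimpleGraph (Fin n)) c ∧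
        IsDistinguishing (⊤ : SimpleGraph (Fin n)) c} =
    sInf {k : ℕ | n ≤ k.choose (k / 2)} := by
  congr 1
  ext k
  constructor
  · rintro ⟨c, hc, -⟩
    exact hc.le_choose
  · intro hk
    obtain ⟨c, hc⟩ := exists_isTypeIColouring_top hn hk
    exact ⟨c, hc, hc.isDistinguishing_top⟩
end

section
/- Let G be a simple graph on a finite vertex set and let k be a positive integer. If the chromatic number of G is at most the binomial coefficient C(k, ⌊k/2⌋), then the symmetric digraph ↔G admits a proper arc-colouring of type I with k colours. -/
/-- If adjacent vertices carry subsets of `Fin k` that are not contained in one another, then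
colouring each arc `(u, v)` with an element of `S u \ S v` is a proper colouring of type I. -/
theorem exists_isTypeIColouring_of_not_subset {V : Type*} (G : SimpleGraph V) {k : ℕ} (hk : 1 ≤ k)
    (S : V → Finset (Fin k)) (hS : ∀ u v, G.Adj u v → ¬ S u ⊆ S v) :
    ∃ c : V → V → Fin k, IsTypeIColouring G c := by
  have key : ∀ u v, ∃ a : Fin k, G.Adj u v → a ∈ S u ∧ a ∉ S v := by
    intro u v
    by_cases huv : G.Adj u v
    · obtain ⟨a, ha⟩ := Finset.not_subset.mp (hS u v huv)
      exact ⟨a, fun _ => ha⟩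
    · exact ⟨⟨0, hk⟩, fun h => absurd h huv⟩
  choose c hc using key
  refine ⟨c, fun u v w huv hvw heq => (hc u v huv).2 ?_⟩
  rw [heq]
  exact (hc v w hvw).1

theorem stmt2 {V : Type*} [Fintype V] (G : SimpleGraph V) (k : ℕ) (hk : 1 ≤ k)
    (h : G.chromaticNumber ≤ (k.choose (k / 2) : ℕ)) :
    ∃ c : V → V → Fin k, IsTypeIColouring G c := by
  obtain ⟨C⟩ := SimpleGraph.chromaticNumber_le_iff_colorable.mp h
  have hcard : Fintype.card (Fin (k.choose (k / 2))) =
      Fintype.card (Finset.powersetCard (k / 2) (Finset.univ : Finset (Fin k))) := by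
    simp
  let e := Fintype.equivOfCardEq hcard
  refine exists_isTypeIColouring_of_not_subset G hk (fun v => (e (C v)).1) fun u v huv hsub => ?_
  have hcard_eq (v : V) : (e (C v)).1.card = k / 2 := (Finset.mem_powersetCard.mp (e (C v)).2).2
  have heq := Finset.eq_of_subset_of_card_le hsub (by rw [hcard_eq, hcard_eq])
  exact C.valid huv (e.injective (Subtype.ext heq))
end

section
/- Let G be a simple graph on a finite vertex set and let k be a positive integer. If the symmetric digraph ↔G admits a proper arc-colouring of type I with k colours, then the chromatic number of G is at most the binomial coefficient C(k, ⌊k/2⌋). -/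
open Finset in
/-- Below the middle of the Boolean lattice, consecutive layers admit an injection
sending every set to a superset. -/
theorem exists_injOn_layer_superset {α : Type*} [Fintype α] [DecidableEq α] (m : ℕ)
    (hm : 2 * m + 1 ≤ Fintype.card α) :
    ∃ f : Finset α → Finset α, (∀ s, #s = m → #(f s) = m + 1 ∧ s ⊆ f s) ∧
      ∀ s t, #s = m → #t = m → f s = f t → s = t := by
  let T : {s : Finset α // #s = m} → Finset (Finset α) :=
    fun s => s.1ᶜ.image fun a => insert a s.1
  have hall : ∀ A : Finset {s : Finset α // #s = m}, #A ≤ #(A.biUnion T) := by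
    intro A
    have key : #A * (Fintype.card α - m) ≤ #(A.biUnion T) * (m + 1) := by
      refine card_mul_le_card_mul (fun s b => b ∈ T s) ?_ ?_
      · intro s hs
        have h1 : #(T s) = Fintype.card α - m := by
          rw [card_image_of_injOn, card_compl, s.2]
          intro a ha b hb hab
          have ha' : a ∉ s.1 := by simpa using ha
          have h2 : a ∈ insert b s.1 := by
            rw [← show insert a s.1 = insert b s.1 from hab]
            exact mem_insert_self _ _
          exact (mem_insert.1 h2).resolve_right ha'
        rw [← h1]
        refine card_le_card fun b hb => ?_
        exact mem_filter.2 ⟨mem_biUnion.2 ⟨s, hs, hb⟩, hb⟩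
      · intro b hb
        obtain ⟨s₀, -, hb₀⟩ := mem_biUnion.1 hb
        obtain ⟨a₀, ha₀, rfl⟩ := mem_image.1 hb₀
        have hcard : #(insert a₀ s₀.1) = m + 1 := by
          rw [card_insert_of_notMem (mem_compl.1 ha₀), s₀.2]
        generalize insert a₀ s₀.1 = b at hcard
        rw [← hcard, ← card_map (Function.Embedding.subtype _)]
        refine le_trans (card_le_card ?_) (card_image_le (s := b) (f := fun a => b.erase a))
        intro s hs
        obtain ⟨r, hr, rfl⟩ := mem_map.1 hs
        obtain ⟨a, ha, rfl⟩ := mem_image.1 (mem_filter.1 hr).2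
        exact mem_image.2 ⟨a, mem_insert_self _ _, erase_insert (mem_compl.1 ha)⟩
    have h2 : #A * (m + 1) ≤ #(A.biUnion T) * (m + 1) :=
      le_trans (Nat.mul_le_mul_left _ (by omega)) key
    exact Nat.le_of_mul_le_mul_right h2 (Nat.succ_pos m)
  obtain ⟨f, hf, hfT⟩ := (all_card_le_biUnion_card_iff_exists_injective T).1 hall
  refine ⟨fun s => if h : #s = m then f ⟨s, h⟩ else s, ?_, ?_⟩
  · intro s hs
    obtain ⟨a, ha, h⟩ := mem_image.1 (hfT ⟨s, hs⟩)
    simp only [hs, dite_true, ← h]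
    exact ⟨by rw [card_insert_of_notMem (mem_compl.1 ha), hs], subset_insert _ _⟩
  · intro s t hs ht h
    simp only [hs, ht, dite_true] at h
    exact congrArg Subtype.val (hf h)

open Finset in
/-- The layers up to the middle of the Boolean lattice are partitioned into chains,
indexed by their top elements. -/
theorem exists_chain_partition_lower {α : Type*} [Fintype α] [DecidableEq α] (m : ℕ)
    (hm : 2 * m ≤ Fintype.card α + 1) :
    ∃ F : Finset α → Finset α, (∀ s, #s ≤ m → #(F s) = m ∧ s ⊆ F s) ∧
      ∀ s t, #s ≤ m → #t ≤ m → F s = F t → s ⊆ t ∨ t ⊆ s := by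
  induction m with
  | zero => exact ⟨id, fun s hs => ⟨by simpa using hs, Subset.rfl⟩, fun s t _ _ h => .inl h.subset⟩
  | succ m ih =>
    obtain ⟨F, hF, hFc⟩ := ih (by omega)
    obtain ⟨u, hu, hui⟩ := exists_injOn_layer_superset (α := α) m (by omega)
    have hsub : ∀ s, #s ≤ m → s ⊆ u (F s) := fun s hs =>
      (hF s hs).2.trans (hu _ (hF s hs).1).2
    refine ⟨fun s => if #s ≤ m then u (F s) else s, fun s hs => ?_, fun s t hs ht h => ?_⟩
    · by_cases h : #s ≤ m
      · simp only [h, if_true]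
        exact ⟨(hu _ (hF s h).1).1, hsub s h⟩
      · simp only [h, if_false]
        exact ⟨by omega, Subset.rfl⟩
    · by_cases h1 : #s ≤ m <;> by_cases h2 : #t ≤ m <;> simp only [h1, h2, if_true, if_false] at h
      · exact hFc s t h1 h2 (hui _ _ (hF s h1).1 (hF t h2).1 h)
      · exact .inl (h ▸ hsub s h1)
      · exact .inr (h ▸ hsub t h2)
      · exact .inl h.subset

open Finset in
/-- The Boolean lattice is partitioned into chains, indexed by the middle layer. -/
theorem exists_chain_partition {α : Type*} [Fintype α] [DecidableEq α] :
    ∃ F : Finset α → Finset α, (∀ s, #(F s) = Fintype.card α / 2) ∧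
      ∀ s t, F s = F t → s ⊆ t ∨ t ⊆ s := by
  set n := Fintype.card α with hn
  obtain ⟨F, hF, hFc⟩ := exists_chain_partition_lower (α := α) (n / 2) (by omega)
  obtain ⟨H, hH, hHc⟩ := exists_chain_partition_lower (α := α) (n - n / 2) (by omega)
  have hcompl : ∀ s : Finset α, ¬ #s ≤ n / 2 → #sᶜ ≤ n - n / 2 := fun s hs => by
    rw [card_compl]; omega
  have hsub : ∀ s : Finset α, ¬ #s ≤ n / 2 → (H sᶜ)ᶜ ⊆ s := fun s hs =>
    compl_le_of_compl_le (hH _ (hcompl s hs)).2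
  refine ⟨fun s => if #s ≤ n / 2 then F s else (H sᶜ)ᶜ, fun s => ?_, fun s t h => ?_⟩
  · by_cases h : #s ≤ n / 2
    · simp only [h, if_true]
      exact (hF s h).1
    · simp only [h, if_false]
      rw [card_compl, (hH _ (hcompl s h)).1]
      omega
  · by_cases h1 : #s ≤ n / 2 <;> by_cases h2 : #t ≤ n / 2 <;>
      simp only [h1, h2, if_true, if_false] at h
    · exact hFc s t h1 h2 h
    · exact .inl ((hF s h1).2.trans (h ▸ hsub t h2))
    · exact .inr ((hF t h2).2.trans (h ▸ hsub s h1))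
    · have := hHc _ _ (hcompl s h1) (hcompl t h2) (compl_injective h)
      simpa only [compl_subset_compl, or_comm] using this

theorem stmt3 {V : Type*} [Fintype V] (G : SimpleGraph V) (k : ℕ) (hk : 1 ≤ k)
    (c : V → V → Fin k) (hc : IsTypeIColouring G c) :
    G.chromaticNumber ≤ (k.choose (k / 2) : ℕ) := by
  classical
  obtain ⟨F, hF, hFc⟩ := exists_chain_partition (α := Fin k)
  let S : V → Finset (Fin k) := fun v => Finset.univ.filter fun i => ∃ w, G.Adj v w ∧ c v w = i
  have hS : ∀ u v, G.Adj u v → ¬ S u ⊆ S v := by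
    intro u v huv hsub
    have hmem : c u v ∈ S u := Finset.mem_filter.2 ⟨Finset.mem_univ _, v, huv, rfl⟩
    obtain ⟨w, hvw, hw⟩ := (Finset.mem_filter.1 (hsub hmem)).2
    exact hc u v w huv hvw hw.symm
  let C : G.Coloring (Finset.powersetCard (k / 2) (Finset.univ : Finset (Fin k))) :=
    SimpleGraph.Coloring.mk
      (fun v => ⟨F (S v), Finset.mem_powersetCard.2
        ⟨Finset.subset_univ _, by simpa using hF (S v)⟩⟩)
      (fun {u v} huv h =>
        (hFc _ _ (congrArg Subtype.val h)).elim (hS u v huv) (hS v u huv.symm))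
  have hcol := C.colorable
  rw [Fintype.card_coe, Finset.card_powersetCard, Finset.card_univ, Fintype.card_fin] at hcol
  exact hcol.chromaticNumber_le
end

section
/- For every k ≥ 1, the least number of colours in a distinguishing proper arc-colouring of type I of the symmetric directed path ↔P_{2k} on 2k vertices equals 2. -/
/-- An automorphism of a path maps the vertex `0` to one of the two ends. -/
theorem pathGraph_iso_zero_eq_zero_or_last {n : ℕ}
    (φ : SimpleGraph.pathGraph n ≃g SimpleGraph.pathGraph n) (hn : 0 < n) :
    (φ ⟨0, hn⟩ : ℕ) = 0 ∨ (φ ⟨0, hn⟩ : ℕ) + 1 = n := by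
  by_contra! h
  have hlt := (φ ⟨0, hn⟩).isLt
  let a : Fin n := ⟨(φ ⟨0, hn⟩ : ℕ) - 1, by omega⟩
  let b : Fin n := ⟨(φ ⟨0, hn⟩ : ℕ) + 1, by omega⟩
  have key : ∀ x : Fin n, (SimpleGraph.pathGraph n).Adj (φ ⟨0, hn⟩) x →
      (φ.symm x : ℕ) = 1 := by
    intro x hx
    have hx' : (SimpleGraph.pathGraph n).Adj ⟨0, hn⟩ (φ.symm x) := by
      rw [← φ.map_adj_iff, φ.apply_symm_apply]
      exact hx
    rw [SimpleGraph.pathGraph_adj] at hx'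
    simp only at hx'
    omega
  have ha := key a (by
    rw [SimpleGraph.pathGraph_adj]
    exact Or.inr (Nat.sub_add_cancel (Nat.one_le_iff_ne_zero.mpr h.1)))
  have hb := key b (by
    rw [SimpleGraph.pathGraph_adj]
    exact Or.inl rfl)
  have hab : a = b := φ.symm.injective (Fin.ext (ha.trans hb.symm))
  have hab' := congrArg Fin.val hab
  simp only [a, b] at hab'
  omega

/-- An automorphism of a path that fixes the vertex `0` is the identity. -/
theorem pathGraph_iso_apply_eq_of_zero {n : ℕ}
    (φ : SimpleGraph.pathGraph n ≃g SimpleGraph.pathGraph n) (hn : 0 < n)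
    (h0 : (φ ⟨0, hn⟩ : ℕ) = 0) (x : Fin n) : φ x = x := by
  obtain ⟨i, hi⟩ := x
  apply Fin.ext
  induction i using Nat.strong_induction_on with
  | _ i ih =>
    rcases i with _ | i
    · exact h0
    · have hadj : (SimpleGraph.pathGraph n).Adj (φ ⟨i, by omega⟩) (φ ⟨i + 1, hi⟩) := by
        rw [φ.map_adj_iff, SimpleGraph.pathGraph_adj]
        exact Or.inl rfl
      rw [SimpleGraph.pathGraph_adj, ih i (by omega) (by omega)] at hadj
      simp only at hadj
      rcases hadj with h | h
      · exact h.symm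
      · exfalso
        have h1 : φ ⟨i - 1, by omega⟩ = φ ⟨i + 1, hi⟩ := by
          apply Fin.ext
          rw [ih (i - 1) (by omega) (by omega)]
          simp only
          omega
        have h2 := congrArg Fin.val (φ.injective h1)
        simp only at h2
        omega

theorem stmt4 (k : ℕ) (hk : 1 ≤ k) :
    sInf {m : ℕ | ∃ c : Fin (2 * k) → Fin (2 * k) → Fin m,
        IsTypeIColouring (SimpleGraph.pathGraph (2 * k)) c ∧
        IsDistinguishing (SimpleGraph.pathGraph (2 * k)) c} = 2 := by
  have h01 : (SimpleGraph.pathGraph (2 * k)).Adj ⟨0, by omega⟩ ⟨1, by omega⟩ := by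
    rw [SimpleGraph.pathGraph_adj]
    exact Or.inl rfl
  refine IsLeast.csInf_eq ⟨?_, ?_⟩
  · -- Colour each arc by the parity of its head.
    refine ⟨fun _ v => ⟨(v : ℕ) % 2, by omega⟩, ?_, ?_⟩
    · intro u v w _ hvw h
      rw [SimpleGraph.pathGraph_adj] at hvw
      have h' := congrArg Fin.val h
      simp only at h'
      omega
    · intro φ hφ
      refine pathGraph_iso_apply_eq_of_zero φ (by omega) ?_
      have hpar := congrArg Fin.val (hφ _ _ h01.symm)
      simp only at hpar
      rcases pathGraph_iso_zero_eq_zero_or_last φ (by omega) with h | h <;> omega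
  · rintro m ⟨c, hc, -⟩
    have hne := Fin.val_ne_of_ne (hc _ _ _ h01 h01.symm)
    omega
end

section
/- For every k ≥ 1, the least number of colours in a distinguishing proper arc-colouring of type I of the symmetric directed path ↔P_{2k+1} on 2k+1 vertices equals 3. -/
/-- Reversal of a path, as a graph automorphism. -/
def pathGraphRev (n : ℕ) : SimpleGraph.pathGraph n ≃g SimpleGraph.pathGraph n where
  toEquiv := Fin.revPerm
  map_rel_iff' := by
    intro a b
    simp only [SimpleGraph.pathGraph_adj, Fin.revPerm_apply, Fin.val_rev]
    omega

/-- An automorphism of a path that fixes its first vertex is the identity. -/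
theorem pathGraph_iso_eq_self_of_map_zero {n : ℕ}
    (φ : SimpleGraph.pathGraph (n + 1) ≃g SimpleGraph.pathGraph (n + 1)) (h0 : φ 0 = 0)
    (x : Fin (n + 1)) : φ x = x := by
  obtain ⟨i, hi⟩ := x
  induction i using Nat.strong_induction_on with
  | _ i ih =>
    rcases i with _ | i
    · exact h0
    have hfix := ih i (by omega) (by omega)
    have hadj : (SimpleGraph.pathGraph (n + 1)).Adj (φ ⟨i, by omega⟩) (φ ⟨i + 1, hi⟩) :=
      φ.map_adj_iff.2 (SimpleGraph.pathGraph_adj.2 (Or.inl rfl))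
    rw [hfix, SimpleGraph.pathGraph_adj] at hadj
    rcases hadj with h | h
    · exact Fin.ext h.symm
    · simp only at h
      have hprev := ih (i - 1) (by omega) (by omega)
      have heq : φ ⟨i + 1, hi⟩ = φ ⟨i - 1, by omega⟩ := by
        rw [hprev]
        apply Fin.ext
        simp only
        omega
      have := congrArg Fin.val (φ.injective heq)
      simp only at this
      omega

/-- With at most two colours, the colour of an arc in a type-I proper colouring of a path is
determined by the parity of its tail. -/
theorem IsTypeIColouring.pathGraph_eq_iff_even {n m : ℕ} (hn : 1 < n) (hm : m ≤ 2)
    {c : Fin n → Fin n → Fin m} (hc : IsTypeIColouring (SimpleGraph.pathGraph n) c)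
    {u v : Fin n} (huv : (SimpleGraph.pathGraph n).Adj u v) :
    c u v = c ⟨0, by omega⟩ ⟨1, hn⟩ ↔ Even u.val := by
  obtain ⟨i, hi⟩ := u
  induction i generalizing v with
  | zero =>
    have hv : v = ⟨1, hn⟩ := by
      rw [SimpleGraph.pathGraph_adj] at huv
      apply Fin.ext
      simp only at huv ⊢
      omega
    simp [hv]
  | succ i ih =>
    have hadj : (SimpleGraph.pathGraph n).Adj ⟨i, by omega⟩ ⟨i + 1, hi⟩ :=
      SimpleGraph.pathGraph_adj.2 (Or.inl rfl)
    have hprev := ih (by omega) hadj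
    have hne := hc _ _ _ hadj huv
    simp only at hprev ⊢
    rw [Nat.even_add_one, ← hprev]
    simp only [ne_eq, Fin.ext_iff] at hne ⊢
    omega

/-- The colouring giving each arc the parity of its tail, except that arcs leaving the first
vertex get a third colour. -/
def tailColouring (n : ℕ) (u _v : Fin n) : Fin 3 :=
  if u.val = 0 then 2 else if u.val % 2 = 0 then 0 else 1

theorem tailColouring_eq_two_iff {n : ℕ} {u v : Fin n} :
    tailColouring n u v = 2 ↔ u.val = 0 := by
  unfold tailColouring
  split_ifs <;> simp_all

theorem isTypeIColouring_tailColouring (n : ℕ) :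
    IsTypeIColouring (SimpleGraph.pathGraph n) (tailColouring n) := by
  intro u v w huv _
  rw [SimpleGraph.pathGraph_adj] at huv
  unfold tailColouring
  split_ifs <;> omega

theorem isDistinguishing_tailColouring {n : ℕ} (hn : 1 ≤ n) :
    IsDistinguishing (SimpleGraph.pathGraph (n + 1)) (tailColouring (n + 1)) := by
  intro φ hφ
  apply pathGraph_iso_eq_self_of_map_zero
  have h := hφ 0 ⟨1, by omega⟩ (SimpleGraph.pathGraph_adj.2 (Or.inl rfl))
  rw [(tailColouring_eq_two_iff (u := (0 : Fin (n + 1)))).2 rfl, tailColouring_eq_two_iff] at h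
  exact Fin.ext h

theorem IsTypeIColouring.not_isDistinguishing_pathGraph {k m : ℕ} (hk : 1 ≤ k) (hm : m ≤ 2)
    {c : Fin (2 * k + 1) → Fin (2 * k + 1) → Fin m}
    (hc : IsTypeIColouring (SimpleGraph.pathGraph (2 * k + 1)) c) :
    ¬ IsDistinguishing (SimpleGraph.pathGraph (2 * k + 1)) c := by
  intro hd
  have hfix := hd (pathGraphRev _) (fun u v huv => by
    have h₁ := hc.pathGraph_eq_iff_even (by omega) hm huv
    have h₂ := hc.pathGraph_eq_iff_even (by omega) hm ((pathGraphRev _).map_adj_iff.2 huv)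
    have hpar : Even (pathGraphRev (2 * k + 1) u).val ↔ Even u.val := by
      change Even (Fin.rev u).val ↔ _
      rw [Fin.val_rev, Nat.even_iff, Nat.even_iff]
      omega
    rw [hpar, ← h₁] at h₂
    simp only [Fin.ext_iff] at h₂ ⊢
    omega) 0
  have h := congrArg Fin.val hfix
  change (Fin.rev (0 : Fin (2 * k + 1))).val = 0 at h
  rw [Fin.val_rev, Fin.val_zero] at h
  omega

theorem stmt5 (k : ℕ) (hk : 1 ≤ k) :
    sInf {m : ℕ | ∃ c : Fin (2 * k + 1) → Fin (2 * k + 1) → Fin m,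
        IsTypeIColouring (SimpleGraph.pathGraph (2 * k + 1)) c ∧
        IsDistinguishing (SimpleGraph.pathGraph (2 * k + 1)) c} = 3 := by
  refine IsLeast.csInf_eq ⟨⟨tailColouring _, isTypeIColouring_tailColouring _,
    isDistinguishing_tailColouring (by omega)⟩, ?_⟩
  rintro m ⟨c, hc, hd⟩
  by_contra hm
  exact hc.not_isDistinguishing_pathGraph hk (by omega) hd
end

section
/- For every n ≥ 3, the least number of colours in a distinguishing proper arc-colouring of type I of the symmetric directed cycle ↔C_n on n vertices equals 3. -/
open SimpleGraph

/-- Adjacency in a cycle, read off from the values of the vertices. -/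
lemma cycleGraph_adj_iff_val {n : ℕ} (hn : 3 ≤ n) (u v : Fin n) :
    (cycleGraph n).Adj u v ↔ v.val = u.val + 1 ∨ u.val = v.val + 1 ∨
      (u.val = 0 ∧ v.val + 1 = n) ∨ (v.val = 0 ∧ u.val + 1 = n) := by
  have sub_val : ∀ a b : Fin n, (a - b).val =
      if b ≤ a then a.val - b.val else n + a.val - b.val := by
    intro a b
    split_ifs with h
    · exact Fin.sub_val_of_le h
    · simp only [Fin.le_def] at h
      simp only [Fin.sub_def]
      rw [Nat.mod_eq_of_lt (by omega)]
      omega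
  rw [cycleGraph_adj', sub_val, sub_val]
  simp only [Fin.le_def]
  split_ifs <;> omega

/-- The reflection of a cycle that fixes the vertex `0`. -/
def cycleGraphNeg (m : ℕ) : cycleGraph (m + 3) ≃g cycleGraph (m + 3) where
  toEquiv := Equiv.neg (Fin (m + 3))
  map_rel_iff' := by
    intro a b
    simp only [cycleGraph_adj, Equiv.neg_apply, neg_sub_neg]
    exact or_comm

open scoped Fin.CommRing in
/-- With at most two colours, the reflection fixing `0` preserves every type-I colouring. -/
lemma IsTypeIColouring.map_cycleGraphNeg {m k : ℕ} (hk : k < 3)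
    {c : Fin (m + 3) → Fin (m + 3) → Fin k} (hc : IsTypeIColouring (cycleGraph (m + 3)) c)
    {u v : Fin (m + 3)} (huv : (cycleGraph (m + 3)).Adj u v) : c (-u) (-v) = c u v := by
  have two : ∀ {a b d : Fin k}, a ≠ b → b ≠ d → a = d := by
    intro a b d h₁ h₂
    omega
  have succ_adj : ∀ x : Fin (m + 3), (cycleGraph (m + 3)).Adj x (x + 1) := by
    intro x
    simp [cycleGraph_adj]
  have neg_adj : ∀ {x y : Fin (m + 3)}, (cycleGraph (m + 3)).Adj x y →
      (cycleGraph (m + 3)).Adj (-x) (-y) := fun h => (cycleGraphNeg m).map_rel_iff.mpr h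
  have forward : ∀ i : ℕ, c (-(i : Fin (m + 3))) (-(i + 1)) = c i (i + 1) := by
    intro i
    induction i with
    | zero =>
      have h := succ_adj 0
      have h' := neg_adj h
      simp only [neg_zero] at h'
      simp only [Nat.cast_zero, neg_zero]
      exact two (hc _ _ _ h' h'.symm) (hc _ _ _ h'.symm h)
    | succ i ih =>
      push_cast
      have h₁ := hc _ _ _ (succ_adj i) (succ_adj (i + 1))
      have h₂ := hc _ _ _ (neg_adj (succ_adj i)) (neg_adj (succ_adj (i + 1)))
      rw [ih] at h₂
      exact two h₂.symm h₁
  have forward' : ∀ x : Fin (m + 3), c (-x) (-(x + 1)) = c x (x + 1) := by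
    intro x
    simpa using forward x.val
  rcases (cycleGraph_adj.mp huv) with h | h
  · obtain rfl : u = v + 1 := by rw [← h]; ring
    have h₁ := hc _ _ _ (succ_adj v) (succ_adj v).symm
    have h₂ := hc _ _ _ (neg_adj (succ_adj v)) (neg_adj (succ_adj v)).symm
    rw [forward'] at h₂
    exact two h₂.symm h₁
  · obtain rfl : v = u + 1 := by rw [← h]; ring
    exact forward' u

lemma three_le_of_isDistinguishing_cycleGraph {n k : ℕ} (hn : 3 ≤ n) {c : Fin n → Fin n → Fin k}
    (hc : IsTypeIColouring (cycleGraph n) c) (hd : IsDistinguishing (cycleGraph n) c) :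
    3 ≤ k := by
  obtain ⟨m, rfl⟩ : ∃ m, n = m + 3 := ⟨n - 3, by omega⟩
  by_contra! hk
  have h : (-1 : Fin (m + 3)) = 1 :=
    hd (cycleGraphNeg m) (fun u v huv => hc.map_cycleGraphNeg hk huv) 1
  have h' := congrArg Fin.val (neg_eq_iff_add_eq_zero.mp h)
  simp only [Fin.val_add, Fin.val_one, Fin.val_zero] at h'
  rw [Nat.mod_eq_of_lt (by omega)] at h'
  omega

/-- An automorphism of a cycle fixing two consecutive vertices is the identity. -/
lemma cycleGraph_iso_eq_self {n : ℕ} (hn : 3 ≤ n) (φ : cycleGraph n ≃g cycleGraph n)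
    (h₀ : ∀ x : Fin n, x.val ≤ 1 → φ x = x) (x : Fin n) : φ x = x := by
  obtain ⟨i, hi⟩ := x
  induction i using Nat.strong_induction_on with
  | _ i ih =>
    by_cases hi1 : i ≤ 1
    · exact h₀ _ hi1
    have e₁ := ih (i - 1) (by omega) (by omega)
    have e₂ := ih (i - 2) (by omega) (by omega)
    have hadj : (cycleGraph n).Adj ⟨i - 1, by omega⟩ ⟨i, hi⟩ := by
      rw [cycleGraph_adj_iff_val hn]
      simp only
      omega
    have hadj' := φ.map_rel_iff.mpr hadj
    have hne : (φ ⟨i, hi⟩).val ≠ i - 2 := by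
      intro h
      have : φ ⟨i, hi⟩ = φ ⟨i - 2, by omega⟩ := by
        rw [e₂]
        exact Fin.ext h
      have := congrArg Fin.val (φ.injective this)
      simp only at this
      omega
    rw [e₁, cycleGraph_adj_iff_val hn] at hadj'
    simp only at hadj'
    apply Fin.ext
    simp only
    have := (φ ⟨i, hi⟩).isLt
    omega

/-- A three-colouring of the arcs of an even cycle in which colour `2` occurs exactly once. -/
def evenCycleColour (u v : ℕ) : Fin 3 :=
  if u = 0 ∧ v = 1 then 2 else if u % 2 = 0 then 0 else 1

/-- A three-colouring of the arcs of an odd cycle in which colour `2` occurs exactly on the two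
arcs entering the vertex `1`. -/
def oddCycleColour (u v : ℕ) : Fin 3 :=
  if v = 1 then 2 else if u = 0 then 1 else if u = 1 ∧ v = 0 then 0
  else if u % 2 = 0 then 0 else 1

lemma exists_isDistinguishing_cycleGraph {n : ℕ} (hn : 3 ≤ n) :
    ∃ c : Fin n → Fin n → Fin 3,
      IsTypeIColouring (cycleGraph n) c ∧ IsDistinguishing (cycleGraph n) c := by
  rcases Nat.even_or_odd n with ⟨m, hm⟩ | ⟨m, hm⟩
  · refine ⟨fun u v => evenCycleColour u v, ?_, ?_⟩
    · intro u v w huv hvw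
      rw [cycleGraph_adj_iff_val hn] at huv hvw
      simp only [evenCycleColour]
      split_ifs <;> first | decide | omega
    · intro φ hφ
      have h01 : (cycleGraph n).Adj ⟨0, by omega⟩ ⟨1, by omega⟩ := by
        simp [cycleGraph_adj_iff_val hn]
      have h := hφ _ _ h01
      apply cycleGraph_iso_eq_self hn φ
      have key : (φ ⟨0, by omega⟩).val = 0 ∧ (φ ⟨1, by omega⟩).val = 1 := by
        simp only [evenCycleColour] at h
        split_ifs at h <;> simp_all
      rintro ⟨i, hi⟩ hi1
      simp only at hi1
      interval_cases i
      · exact Fin.ext key.1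
      · exact Fin.ext key.2
  · refine ⟨fun u v => oddCycleColour u v, ?_, ?_⟩
    · intro u v w huv hvw
      rw [cycleGraph_adj_iff_val hn] at huv hvw
      simp only [oddCycleColour]
      split_ifs <;> first | decide | omega
    · intro φ hφ
      have h01 : (cycleGraph n).Adj ⟨0, by omega⟩ ⟨1, by omega⟩ := by
        simp [cycleGraph_adj_iff_val hn]
      have h := hφ _ _ h01
      have h' := hφ _ _ h01.symm
      have hadj := φ.map_rel_iff.mpr h01
      rw [cycleGraph_adj_iff_val hn] at hadj
      apply cycleGraph_iso_eq_self hn φ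
      have key₁ : (φ ⟨1, by omega⟩).val = 1 := by
        simp only [oddCycleColour] at h
        split_ifs at h <;> simp_all
      have key₀ : (φ ⟨0, by omega⟩).val = 0 := by
        by_contra hne
        have : (φ ⟨0, by omega⟩).val = 2 := by omega
        simp [oddCycleColour, key₁, this] at h'
      rintro ⟨i, hi⟩ hi1
      simp only at hi1
      interval_cases i
      · exact Fin.ext key₀
      · exact Fin.ext key₁

theorem stmt6 (n : ℕ) (hn : 3 ≤ n) :
    sInf {m : ℕ | ∃ c : Fin n → Fin n → Fin m,
        IsTypeIColouring (SimpleGraph.cycleGraph n) c ∧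
        IsDistinguishing (SimpleGraph.cycleGraph n) c} = 3 := by
  refine IsLeast.csInf_eq ⟨exists_isDistinguishing_cycleGraph hn, ?_⟩
  rintro k ⟨c, hc, hd⟩
  exact three_le_of_isDistinguishing_cycleGraph hn hc hd
end

section
/- Let G be a connected simple graph on a finite vertex set with at least one edge and with maximum degree Δ. Then the symmetric digraph ↔G admits a distinguishing proper arc-colouring of type I with ⌈2√Δ⌉ colours. -/
namespace ArcColouring

/-- The pairs of colours available for the arcs `(w, x)` and `(x, w)` when the arcs leaving `w` are
coloured from `S` and those leaving `x` from `X`. -/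
def labels {k : ℕ} (S X : Finset (Fin k)) : Finset (Fin k × Fin k) := (S \ X) ×ˢ (X \ S)

lemma mem_labels {k : ℕ} {S X : Finset (Fin k)} {t : Fin k × Fin k} :
    t ∈ labels S X ↔ (t.1 ∈ S ∧ t.1 ∉ X) ∧ t.2 ∈ X ∧ t.2 ∉ S := by
  simp [labels]

section Framework

variable {V : Type*} {k : ℕ}

/-- Inside `B`, every arc `(u, v)` has a colour in `O u \ O v`. -/
def RespectsOn (G : SimpleGraph V) (O : V → Finset (Fin k)) (c : V → V → Fin k)
    (B : Finset V) : Prop :=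
  ∀ u ∈ B, ∀ v ∈ B, G.Adj u v → c u v ∈ O u ∧ c u v ∉ O v

/-- The colours inside `B` force an automorphism fixing `r` to fix `B` pointwise, in every type-I
extension of the colouring. -/
def RigidOn (G : SimpleGraph V) (c : V → V → Fin k) (r : V) (B : Finset V) : Prop :=
  ∀ c' : V → V → Fin k, (∀ u ∈ B, ∀ v ∈ B, G.Adj u v → c' u v = c u v) →
    IsTypeIColouring G c' → ∀ φ : G ≃g G,
      (∀ u v, G.Adj u v → c' (φ u) (φ v) = c' u v) → φ r = r → ∀ x ∈ B, φ x = x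

/-- Recolour the arcs at `w`: `τ x` is the pair of colours of `(w, x)` and `(x, w)`. -/
def extendArcs [DecidableEq V] (c : V → V → Fin k) (w : V) (τ : V → Fin k × Fin k)
    (u v : V) : Fin k :=
  if u = w then (τ v).1 else if v = w then (τ u).2 else c u v

section extendArcs

variable [DecidableEq V] (c : V → V → Fin k) (w : V) (τ : V → Fin k × Fin k)

@[simp] lemma extendArcs_left (v : V) : extendArcs c w τ w v = (τ v).1 := by
  simp [extendArcs]

lemma extendArcs_right {u : V} (hu : u ≠ w) : extendArcs c w τ u w = (τ u).2 := by
  simp [extendArcs, hu]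

lemma extendArcs_of_ne {u v : V} (hu : u ≠ w) (hv : v ≠ w) : extendArcs c w τ u v = c u v := by
  simp [extendArcs, hu, hv]

end extendArcs

lemma RespectsOn.isTypeI {G : SimpleGraph V} {O : V → Finset (Fin k)} {c : V → V → Fin k}
    {B : Finset V} (h : RespectsOn G O c B) (hB : ∀ x, x ∈ B) : IsTypeIColouring G c := by
  intro u v w huv hvw he
  exact (h u (hB u) v (hB v) huv).2 (he ▸ (h v (hB v) w (hB w) hvw).1)

lemma RespectsOn.extend [DecidableEq V] {G : SimpleGraph V} {O : V → Finset (Fin k)}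
    {c : V → V → Fin k} {B : Finset V} {w : V} {S : Finset (Fin k)} {τ : V → Fin k × Fin k}
    (h : RespectsOn G O c B) (hw : w ∉ B)
    (hτ : ∀ x ∈ B, G.Adj w x → τ x ∈ labels S (O x)) :
    RespectsOn G (Function.update O w S) (extendArcs c w τ) (insert w B) := by
  have hne : ∀ x ∈ B, x ≠ w := fun x hx e => hw (e ▸ hx)
  simp only [mem_labels] at hτ
  intro u hu v hv huv
  rcases Finset.mem_insert.1 hu with rfl | huB
  · rcases Finset.mem_insert.1 hv with rfl | hv
    · exact (G.irrefl huv).elim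
    · simpa [hne v hv] using (hτ v hv huv).1
  · rcases Finset.mem_insert.1 hv with rfl | hv
    · simpa [hne u huB, extendArcs_right _ _ _ (hne u huB)] using (hτ u huB huv.symm).2
    · simpa [hne u huB, hne v hv, extendArcs_of_ne _ _ _ (hne u huB) (hne v hv)] using h u huB v hv huv

/-- Vertices outside `T` that have the same neighbours in `T` can be told apart by the colours of
their arcs to `T`, unless they are adjacent. -/
lemma RigidOn.union [DecidableEq V] {G : SimpleGraph V} {c c' : V → V → Fin k} {r w₀ : V}
    {T C : Finset V} (hT : RigidOn G c r T) (hc : ∀ u ∈ T, ∀ v ∈ T, c' u v = c u v)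
    (hC : ∀ z, z ∈ C ↔ z ∉ T ∧ ∀ x ∈ T, G.Adj z x ↔ G.Adj w₀ x)
    (hsep : ∀ y ∈ C, ∀ z ∈ C, y ≠ z → ¬ G.Adj y z →
      ∃ x ∈ T, G.Adj y x ∧ (c' y x, c' x y) ≠ (c' z x, c' x z)) :
    RigidOn G c' r (T ∪ C) := by
  intro d hd hdI φ hφ hr
  have hfix : ∀ x ∈ T, φ x = x :=
    hT d (fun u hu v hv huv => (hd u (Finset.mem_union_left _ hu) v
      (Finset.mem_union_left _ hv) huv).trans (hc u hu v hv)) hdI φ hφ hr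
  intro x hx
  rcases Finset.mem_union.1 hx with hx | hxC
  · exact hfix x hx
  by_contra hne
  obtain ⟨hxT, hxw⟩ := (hC x).1 hxC
  have hadj : ∀ y ∈ T, (G.Adj (φ x) y ↔ G.Adj x y) := fun y hy => by
    conv_lhs => rw [← hfix y hy]
    exact φ.map_adj_iff
  have hφT : φ x ∉ T := fun h => hne (φ.injective (hfix _ h))
  have hφC : φ x ∈ C := (hC _).2 ⟨hφT, fun y hy => (hadj y hy).trans (hxw y hy)⟩
  by_cases hxφ : G.Adj x (φ x)
  · exact hdI x (φ x) (φ (φ x)) hxφ (φ.map_adj_iff.2 hxφ) (hφ _ _ hxφ).symm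
  · obtain ⟨y, hy, hxy, hlab⟩ := hsep x hxC (φ x) hφC (Ne.symm hne) hxφ
    have hφxy := (hadj y hy).2 hxy
    have h1 := hφ x y hxy
    have h2 := hφ y x hxy.symm
    rw [hfix y hy] at h1 h2
    have m1 : y ∈ T ∪ C := Finset.mem_union_left _ hy
    have m2 : φ x ∈ T ∪ C := Finset.mem_union_right _ hφC
    rw [hd _ m2 _ m1 hφxy, hd _ hx _ m1 hxy] at h1
    rw [hd _ m1 _ m2 hφxy.symm, hd _ m1 _ hx hxy.symm] at h2
    exact hlab (by rw [h1, h2])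

/-- Colourings can be built vertex by vertex from a rigid start, provided every vertex can be
added in such a way that it is separated from the earlier vertices of its class. -/
theorem exists_rigid_colouring [Fintype V] [DecidableEq V] {G : SimpleGraph V}
    (hconn : G.Connected)
    (Inv : Finset V → (V → Finset (Fin k)) → (V → V → Fin k) → Prop) {r : V} {T₀ : Finset V}
    {O₀ : V → Finset (Fin k)} {c₀ : V → V → Fin k} (hr : r ∈ T₀)
    (hnbr : ∀ x ∈ T₀, ∃ y ∈ T₀, G.Adj x y)
    (hresp : RespectsOn G O₀ c₀ T₀) (hrigid : RigidOn G c₀ r T₀) (hInv : Inv T₀ O₀ c₀)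
    (hcongr : ∀ T O c O' c', Inv T O c → (∀ x ∈ T, O' x = O x) →
      (∀ u ∈ T, ∀ v ∈ T, c' u v = c u v) → Inv T O' c')
    (hstep : ∀ T B O c w, T₀ ⊆ T → T ⊆ B → RespectsOn G O c B → Inv T O c → Inv B O c →
      w ∉ B → (∃ x ∈ T, G.Adj w x) → (∀ z ∈ B, z ∉ T → ∀ x ∈ T, (G.Adj z x ↔ G.Adj w x)) →
      (∀ x ∈ T, ∃ y ∈ T, G.Adj x y) →
      ∃ (S : Finset (Fin k)) (τ : V → Fin k × Fin k),
        (∀ x ∈ B, G.Adj w x → τ x ∈ labels S (O x)) ∧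
        (∀ z ∈ B, z ∉ T → ¬ G.Adj w z → ∃ x ∈ T, G.Adj w x ∧ τ x ≠ (c z x, c x z)) ∧
        Inv (insert w B) (Function.update O w S) (extendArcs c w τ)) :
    ∃ (O : V → Finset (Fin k)) (c : V → V → Fin k), RespectsOn G O c Finset.univ ∧
      Inv Finset.univ O c ∧ RigidOn G c r Finset.univ := by
  classical
  suffices H : ∀ n : ℕ, ∀ (T : Finset V) (O : V → Finset (Fin k)) (c : V → V → Fin k),
      Tᶜ.card = n → T₀ ⊆ T → (∀ x ∈ T, ∃ y ∈ T, G.Adj x y) → RespectsOn G O c T → Inv T O c →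
      RigidOn G c r T → ∃ (O : V → Finset (Fin k)) (c : V → V → Fin k),
        RespectsOn G O c Finset.univ ∧ Inv Finset.univ O c ∧ RigidOn G c r Finset.univ from
    H _ T₀ O₀ c₀ rfl subset_rfl hnbr hresp hInv hrigid
  intro n
  induction n using Nat.strong_induction_on with
  | _ n ih =>
  intro T O c hn hT₀ hTn hRT hIT hRig
  by_cases hTu : T = Finset.univ
  · subst hTu; exact ⟨O, c, hRT, hIT, hRig⟩
  obtain ⟨v, hv⟩ : ∃ v, v ∉ T := by
    by_contra! h; exact hTu (Finset.eq_univ_iff_forall.2 h)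
  obtain ⟨p⟩ := hconn.preconnected r v
  obtain ⟨⟨⟨a, w₀⟩, haw⟩, -, ha, hw₀⟩ := p.exists_boundary_dart (T : Set V)
    (by simpa using hT₀ hr) (by simpa using hv)
  simp only [Finset.mem_coe] at ha hw₀ haw
  set C : Finset V := Finset.univ.filter (fun z => z ∉ T ∧ ∀ x ∈ T, (G.Adj z x ↔ G.Adj w₀ x))
    with hCdef
  have hC : ∀ z, z ∈ C ↔ z ∉ T ∧ ∀ x ∈ T, (G.Adj z x ↔ G.Adj w₀ x) := by simp [C]
  have inner : ∀ C' ⊆ C, ∃ (O' : V → Finset (Fin k)) (c' : V → V → Fin k),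
      (∀ x ∈ T, O' x = O x) ∧ (∀ u ∈ T, ∀ v ∈ T, c' u v = c u v) ∧
      RespectsOn G O' c' (T ∪ C') ∧ Inv (T ∪ C') O' c' ∧
      ∀ y ∈ C', ∀ z ∈ C', y ≠ z → ¬ G.Adj y z →
        ∃ x ∈ T, G.Adj y x ∧ (c' y x, c' x y) ≠ (c' z x, c' x z) := by
    intro C'
    induction C' using Finset.induction_on with
    | empty => intro _; exact ⟨O, c, by simp, by simp, by simpa using hRT, by simpa using hIT, by simp⟩
    | insert w C' hwC' ihC =>
      intro hsub
      obtain ⟨O', c', hO', hc', hR', hI', hS'⟩ := ihC ((Finset.subset_insert _ _).trans hsub)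
      obtain ⟨hwT, hww⟩ := (hC w).1 (hsub (Finset.mem_insert_self _ _))
      have hC'C : ∀ z ∈ C', z ∈ C := fun z hz => hsub (Finset.mem_insert_of_mem hz)
      have hwB : w ∉ T ∪ C' := by simp [hwT, hwC']
      have htw : ∀ z ∈ T ∪ C', z ∉ T → ∀ x ∈ T, (G.Adj z x ↔ G.Adj w x) := by
        intro z hz hzT x hx
        have hz' : z ∈ C' := (Finset.mem_union.1 hz).resolve_left hzT
        rw [((hC z).1 (hC'C z hz')).2 x hx, hww x hx]
      obtain ⟨S, τ, h1, h2, h3⟩ := hstep T (T ∪ C') O' c' w hT₀ Finset.subset_union_left hR'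
        (hcongr _ _ _ _ _ hIT hO' hc') hI' hwB ⟨a, ha, (hww a ha).2 haw.symm⟩ htw hTn
      have hneT : ∀ x ∈ T, x ≠ w := fun x hx e => hwT (e ▸ hx)
      have hneC : ∀ x ∈ C', x ≠ w := fun x hx e => hwC' (e ▸ hx)
      refine ⟨Function.update O' w S, extendArcs c' w τ, ?_, ?_, ?_, ?_, ?_⟩
      · intro x hx; simp [hneT x hx, hO' x hx]
      · intro u hu v hv
        rw [extendArcs_of_ne _ _ _ (hneT u hu) (hneT v hv), hc' u hu v hv]
      · rw [Finset.union_insert]; exact hR'.extend hwB h1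
      · rw [Finset.union_insert]; exact h3
      · have key : ∀ z ∈ C', ¬ G.Adj w z → ∃ x ∈ T, G.Adj w x ∧
            τ x ≠ (c' z x, c' x z) := fun z hz hwz => h2 z (Finset.mem_union_right _ hz)
              ((hC z).1 (hC'C z hz)).1 hwz
        intro y hy z hz hyz hnadj
        rcases Finset.mem_insert.1 hy with rfl | hyC
        · have hz := (Finset.mem_insert.1 hz).resolve_left (Ne.symm hyz)
          obtain ⟨x, hx, hwx, hl⟩ := key z hz hnadj
          refine ⟨x, hx, hwx, ?_⟩
          rw [extendArcs_left, extendArcs_right _ _ _ (hneT x hx),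
            extendArcs_of_ne _ _ _ (hneC z hz) (hneT x hx),
            extendArcs_of_ne _ _ _ (hneT x hx) (hneC z hz)]
          exact hl
        · rcases Finset.mem_insert.1 hz with rfl | hz
          · obtain ⟨x, hx, hwx, hl⟩ := key y hyC (fun h => hnadj h.symm)
            refine ⟨x, hx, ?_, ?_⟩
            · rwa [htw y (Finset.mem_union_right _ hyC) ((hC y).1 (hC'C y hyC)).1 x hx]
            rw [extendArcs_left, extendArcs_right _ _ _ (hneT x hx),
              extendArcs_of_ne _ _ _ (hneC y hyC) (hneT x hx),
              extendArcs_of_ne _ _ _ (hneT x hx) (hneC y hyC)]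
            exact hl.symm
          · obtain ⟨x, hx, hyx, hl⟩ := hS' y hyC z hz hyz hnadj
            refine ⟨x, hx, hyx, ?_⟩
            rwa [extendArcs_of_ne _ _ _ (hneC z hz) (hneT x hx),
              extendArcs_of_ne _ _ _ (hneT x hx) (hneC z hz),
              extendArcs_of_ne _ _ _ (hneC y hyC) (hneT x hx),
              extendArcs_of_ne _ _ _ (hneT x hx) (hneC y hyC)]
  obtain ⟨O', c', hO', hc', hR', hI', hS'⟩ := inner C subset_rfl
  refine ih (T ∪ C)ᶜ.card ?_ (T ∪ C) O' c' rfl (hT₀.trans Finset.subset_union_left) ?_ hR' hI'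
    (hRig.union hc' hC hS')
  · rw [← hn]
    refine Finset.card_lt_card (Finset.compl_ssubset_compl.2
      ((Finset.ssubset_iff_of_subset Finset.subset_union_left).2
        ⟨w₀, Finset.mem_union_right _ ((hC w₀).2 ⟨by simpa using hw₀, fun _ _ => Iff.rfl⟩),
          by simpa using hw₀⟩))
  · intro x hx
    rcases Finset.mem_union.1 hx with hx | hx
    · obtain ⟨y, hy, h⟩ := hTn x hx; exact ⟨y, Finset.mem_union_left _ hy, h⟩
    · exact ⟨a, Finset.mem_union_left _ ha, (((hC x).1 hx).2 a ha).2 haw.symm⟩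

/-- The start of the construction: the neighbours of `r` are told apart by their arcs to `r`. -/
lemma exists_rigid_star [DecidableEq V] {G : SimpleGraph V} {r : V} {N : Finset V}
    (hN : ∀ x, x ∈ N ↔ G.Adj r x) {O : V → Finset (Fin k)} {ι : V → Fin k × Fin k}
    (hinj : Set.InjOn ι N) (hι : ∀ w ∈ N, ι w ∈ labels (O r) (O w))
    (hne : ∀ w ∈ N, ∀ w' ∈ N, G.Adj w w' → ∃ a ∈ O w, a ∉ O w') :
    ∃ c : V → V → Fin k, (∀ w ∈ N, c r w = (ι w).1 ∧ c w r = (ι w).2) ∧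
      RespectsOn G O c (insert r N) ∧ RigidOn G c r (insert r N) := by
  classical
  simp only [mem_labels] at hι
  let c : V → V → Fin k := fun u v => if u = r then (ι v).1 else if v = r then (ι u).2 else
    if h : ∃ a ∈ O u, a ∉ O v then h.choose else (ι u).1
  have hrN : ∀ w ∈ N, w ≠ r := fun w hw e => G.irrefl (e ▸ (hN w).1 hw)
  have hc : ∀ w ∈ N, c r w = (ι w).1 ∧ c w r = (ι w).2 := fun w hw => by simp [c, hrN w hw]
  refine ⟨c, hc, ?_, ?_⟩
  · intro u hu v hv huv
    rcases Finset.mem_insert.1 hu with rfl | huN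
    · have hvN := (hN v).2 huv
      rw [(hc v hvN).1]; exact (hι v hvN).1
    · rcases Finset.mem_insert.1 hv with rfl | hvN
      · rw [(hc u huN).2]; exact (hι u huN).2
      · have h := hne u huN v hvN huv
        have : c u v = h.choose := by simp [c, hrN u huN, hrN v hvN, h]
        rw [this]; exact h.choose_spec
  · intro d hd _ φ hφ hr x hx
    rcases Finset.mem_insert.1 hx with rfl | hxN
    · exact hr
    have hrx := (hN x).1 hxN
    have hrφ : G.Adj r (φ x) := by
      simpa only [hr] using φ.map_adj_iff.2 hrx
    have hφN := (hN _).2 hrφ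
    have h1 := hφ r x hrx
    have h2 := hφ x r hrx.symm
    have mr := Finset.mem_insert_self r N
    have mφ := Finset.mem_insert_of_mem (b := r) hφN
    rw [hr, hd _ mr _ mφ hrφ, hd _ mr _ hx hrx, (hc _ hφN).1, (hc _ hxN).1] at h1
    rw [hr, hd _ mφ _ mr hrφ.symm, hd _ hx _ mr hrx.symm, (hc _ hφN).2, (hc _ hxN).2] at h2
    exact hinj hφN hxN (Prod.ext h1 h2)

/-- A neighbour `v ∈ T` of `w` is adjacent to all twins of `w` outside `T`. -/
lemma card_twins_le [DecidableEq V] {G : SimpleGraph V} {Δ : ℕ}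
    (hΔ : ∀ x (s : Finset V), (∀ y ∈ s, G.Adj x y) → s.card ≤ Δ) {T B s : Finset V} {v w : V}
    (hT : T ⊆ B) (hw : w ∉ B) (hv : v ∈ T) (hwv : G.Adj w v)
    (htw : ∀ z ∈ B, z ∉ T → ∀ x ∈ T, (G.Adj z x ↔ G.Adj w x)) (hs : s ⊆ T)
    (hvs : ∀ y ∈ s, G.Adj v y) : (B \ T).card + s.card + 1 ≤ Δ := by
  have hdisj : Disjoint (B \ T) s := Finset.disjoint_of_subset_right hs Finset.sdiff_disjoint
  have hwn : w ∉ (B \ T) ∪ s := by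
    simp only [Finset.mem_union, Finset.mem_sdiff, not_or]
    exact ⟨fun h => hw h.1, fun h => hw (hT (hs h))⟩
  rw [← Finset.card_union_of_disjoint hdisj, ← Finset.card_insert_of_notMem hwn]
  refine hΔ v _ fun y hy => ?_
  rcases Finset.mem_insert.1 hy with rfl | hy
  · exact hwv.symm
  rcases Finset.mem_union.1 hy with hy | hy
  · obtain ⟨h1, h2⟩ := Finset.mem_sdiff.1 hy
    exact ((htw y h1 h2 v hv).2 hwv).symm
  · exact hvs y hy

end Framework

section Labels

variable {k : ℕ}

lemma labels_nonempty {S X : Finset (Fin k)} (hc : S.card = X.card) (hne : S ≠ X) :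
    (labels S X).Nonempty := by
  refine Finset.Nonempty.product ?_ ?_ <;> rw [Finset.sdiff_nonempty] <;> intro h
  · exact hne (Finset.eq_of_subset_of_card_le h hc.ge)
  · exact hne (Finset.eq_of_subset_of_card_le h hc.le).symm

lemma card_labels {S X : Finset (Fin k)} (hc : S.card = X.card) :
    (labels S X).card = (S \ X).card * (S \ X).card := by
  rw [labels, Finset.card_product, Finset.card_sdiff_comm hc.symm]

/-- Exchange `t.2` for `t.1`. -/
def exchange (X : Finset (Fin k)) (t : Fin k × Fin k) : Finset (Fin k) := insert t.1 (X.erase t.2)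

lemma card_exchange {X : Finset (Fin k)} {t : Fin k × Fin k} (h1 : t.1 ∉ X) (h2 : t.2 ∈ X) :
    (exchange X t).card = X.card := by
  rw [exchange, Finset.card_insert_of_notMem (by simp [h1]), Finset.card_erase_add_one h2]

lemma mem_labels_exchange {X : Finset (Fin k)} {t : Fin k × Fin k} (h1 : t.1 ∉ X) (h2 : t.2 ∈ X) :
    t ∈ labels (exchange X t) X := by
  have : t.2 ≠ t.1 := fun h => h1 (h ▸ h2)
  simp [mem_labels, exchange, h1, h2, this]

lemma labels_exchange {X : Finset (Fin k)} {t : Fin k × Fin k} (h1 : t.1 ∉ X) (h2 : t.2 ∈ X) :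
    labels (exchange X t) X = {t} := by
  have : t.2 ≠ t.1 := fun h => h1 (h ▸ h2)
  ext s
  simp only [mem_labels, exchange, Finset.mem_insert, Finset.mem_erase, Finset.mem_singleton,
    Prod.ext_iff]
  grind

lemma exchange_eq {S X : Finset (Fin k)} {t : Fin k × Fin k} (hc : S.card = X.card)
    (h1 : (S \ X).card = 1) (ht : t ∈ labels S X) : S = exchange X t := by
  have h2 : (X \ S).card = 1 := by rw [Finset.card_sdiff_comm hc.symm, h1]
  obtain ⟨a, ha⟩ := Finset.card_eq_one.1 h1
  obtain ⟨b, hb⟩ := Finset.card_eq_one.1 h2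
  rw [labels, ha, hb] at ht
  simp only [Finset.singleton_product_singleton,
    Finset.mem_singleton] at ht
  subst ht
  ext x
  have hax := Finset.ext_iff.1 ha x
  have hbx := Finset.ext_iff.1 hb x
  simp only [Finset.mem_sdiff, Finset.mem_singleton] at hax hbx
  simp only [exchange, Finset.mem_insert, Finset.mem_erase]
  tauto

lemma exchange_injOn (X : Finset (Fin k)) :
    Set.InjOn (exchange X) {t | t.1 ∉ X ∧ t.2 ∈ X} := by
  intro s hs t ht h
  have := labels_exchange hs.1 hs.2
  rw [h, labels_exchange ht.1 ht.2] at this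
  exact (Finset.singleton_injective this).symm

/-- Some label at a `p`-set is not used by `Z`. -/
lemma card_unused_labels {α : Type*} {Z : Finset α} {f : α → Fin k × Fin k} {X : Finset (Fin k)} :
    X.card * (k - X.card) ≤ ((Xᶜ ×ˢ X) \ Z.image f).card + Z.card := by
  have h1 := Finset.le_card_sdiff (Z.image f) (Xᶜ ×ˢ X)
  have h2 : (Z.image f).card ≤ Z.card := Finset.card_image_le
  rw [Finset.card_product, Finset.card_compl, Fintype.card_fin, mul_comm] at h1
  omega

lemma exists_exchange {α : Type*} {p : ℕ} {Z : Finset α} {f : α → Fin k × Fin k}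
    {X : Finset (Fin k)} {E : Finset (Finset (Fin k))} (hX : X.card = p)
    (h : E.card + Z.card < p * (k - p)) :
    ∃ t : Fin k × Fin k, t.1 ∉ X ∧ t.2 ∈ X ∧ exchange X t ∉ E ∧ ∀ z ∈ Z, t ≠ f z := by
  subst hX
  have hU := card_unused_labels (Z := Z) (f := f) (X := X)
  have hinj : ((((Xᶜ ×ˢ X) \ Z.image f)).image (exchange X)).card =
      ((Xᶜ ×ˢ X) \ Z.image f).card := by
    refine Finset.card_image_of_injOn ((exchange_injOn X).mono fun t ht => ?_)
    have := (Finset.mem_sdiff.1 ht).1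
    simpa using this
  obtain ⟨S, hS, hSE⟩ := Finset.exists_mem_notMem_of_card_lt_card
    (s := E) (t := ((Xᶜ ×ˢ X) \ Z.image f).image (exchange X)) (by omega)
  obtain ⟨t, ht, rfl⟩ := Finset.mem_image.1 hS
  simp only [Finset.mem_sdiff, Finset.mem_product, Finset.mem_compl, Finset.mem_image,
    not_exists, not_and] at ht
  exact ⟨t, ht.1.1, ht.1.2, hSE, fun z hz e => ht.2 z hz e.symm⟩

lemma choose_le_card_separating {p : ℕ} {t : Fin k × Fin k} (hp : 1 ≤ p) (ht : t.1 ≠ t.2) :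
    (k - 2).choose (p - 1) ≤
      ((Finset.powersetCard p Finset.univ).filter fun S => t.1 ∈ S ∧ t.2 ∉ S).card := by
  have hc : ((Finset.univ.erase t.1).erase t.2).card = k - 2 := by
    rw [Finset.card_erase_of_mem (by simp [ht.symm]), Finset.card_erase_of_mem (by simp)]
    simp; omega
  rw [← hc, ← Finset.card_powersetCard]
  refine Finset.card_le_card_of_injOn (insert t.1) ?_ ?_
  · intro S hS
    obtain ⟨hS1, hS2⟩ := Finset.mem_powersetCard.1 hS
    have h1 : t.1 ∉ S := fun h => by simpa using hS1 h
    have h2 : t.2 ∉ S := fun h => by simpa using hS1 h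
    simp [Finset.mem_powersetCard, Finset.card_insert_of_notMem h1, hS2, h2, ht.symm]
    omega
  · intro S hS S' hS' h
    have h1 : ∀ S ∈ Finset.powersetCard (p - 1) ((Finset.univ.erase t.1).erase t.2), t.1 ∉ S :=
      fun S hS h => by simpa using (Finset.mem_powersetCard.1 hS).1 h
    rw [← Finset.erase_insert (h1 S hS), ← Finset.erase_insert (h1 S' hS')]
    exact congrArg (fun A => A.erase t.1) h

lemma two_mul_add_two_le_centralBinom {h : ℕ} (hh : 4 ≤ h) :
    2 * (h * (h + 1) + 2) ≤ h.centralBinom := by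
  induction h, hh using Nat.le_induction with
  | base => decide
  | succ n hn ih =>
    have h1 := Nat.succ_mul_centralBinom_succ n
    nlinarith

lemma mul_add_two_le_choose {k : ℕ} (hk : 8 ≤ k) :
    k / 2 * (k - k / 2) + 2 ≤ (k - 2).choose (k / 2 - 1) := by
  rcases hk.eq_or_lt with rfl | hk
  · decide
  rcases Nat.even_or_odd' k with ⟨h, rfl | rfl⟩
  · obtain ⟨n, rfl⟩ : ∃ n, h = n + 1 := ⟨h - 1, by omega⟩
    have := two_mul_add_two_le_centralBinom (h := n) (by omega)
    have e1 : 2 * (n + 1) / 2 = n + 1 := by omega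
    have e2 : 2 * (n + 1) - (n + 1) = n + 1 := by omega
    have e3 : 2 * (n + 1) - 2 = 2 * n := by omega
    rw [e1, e2, e3, Nat.add_sub_cancel]
    rw [Nat.centralBinom] at this
    nlinarith
  · obtain ⟨n, rfl⟩ : ∃ n, h = n + 1 := ⟨h - 1, by omega⟩
    have := two_mul_add_two_le_centralBinom (h := n + 1) (by omega)
    have e1 : (2 * (n + 1) + 1) / 2 = n + 1 := by omega
    have e2 : 2 * (n + 1) + 1 - (n + 1) = n + 2 := by omega
    have e3 : 2 * (n + 1) + 1 - 2 = 2 * n + 1 := by omega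
    rw [e1, e2, e3, Nat.add_sub_cancel]
    have e4 : (n + 1).centralBinom = 2 * (2 * n + 1).choose n := by
      rw [Nat.centralBinom, show 2 * (n + 1) = (2 * n + 1) + 1 by ring, Nat.choose_succ_succ,
        Nat.choose_symm_half]
      ring
    rw [e4] at this
    linarith

/-- Two distinct pairs from a 5-set have at most four common exchange neighbours. -/
lemma card_common_exchange_le {S₁ S₂ : Finset (Fin 5)} (h₁ : S₁.card = 2) (h₂ : S₂.card = 2)
    (hne : S₁ ≠ S₂) :
    ((Finset.powersetCard 2 Finset.univ).filter
      fun X => (S₁ \ X).card = 1 ∧ (S₂ \ X).card = 1).card ≤ 4 := by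
  have key : ∀ S₁ ∈ Finset.powersetCard 2 (Finset.univ : Finset (Fin 5)),
      ∀ S₂ ∈ Finset.powersetCard 2 (Finset.univ : Finset (Fin 5)), S₁ ≠ S₂ →
      ((Finset.powersetCard 2 Finset.univ).filter
        fun X => (S₁ \ X).card = 1 ∧ (S₂ \ X).card = 1).card ≤ 4 := by
    decide +kernel
  exact key S₁ (by simp [Finset.mem_powersetCard, h₁]) S₂
    (by simp [Finset.mem_powersetCard, h₂]) hne

section Exchange

variable {α : Type*} {p : ℕ} {D Z : Finset α} {O : α → Finset (Fin k)}
  {lab : α → α → Fin k × Fin k} {E : Finset (Finset (Fin k))}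

/-- `S` fits next to `D` and can be separated there from all of `Z`. -/
def Separates (D Z : Finset α) (O : α → Finset (Fin k)) (lab : α → α → Fin k × Fin k)
    (S : Finset (Fin k)) : Prop :=
  ∃ τ : α → Fin k × Fin k, (∀ x ∈ D, τ x ∈ labels S (O x)) ∧ ∀ z ∈ Z, ∃ x ∈ D, τ x ≠ lab z x

lemma exists_separates_of_label {S : Finset (Fin k)} {v : α} {t : Fin k × Fin k}
    (hne : ∀ x ∈ D, (labels S (O x)).Nonempty) (hv : v ∈ D) (ht : t ∈ labels S (O v))
    (hZ : ∀ z ∈ Z, t ≠ lab z v) : Separates D Z O lab S := by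
  classical
  have : Nonempty (Fin k × Fin k) := ⟨t⟩
  choose! τ hτ using hne
  refine ⟨fun x => if x = v then t else τ x, fun x hx => ?_, fun z hz => ⟨v, hv, by simpa using hZ z hz⟩⟩
  by_cases h : x = v
  · subst h; simpa using ht
  · simpa [h] using hτ x hx

/-- If `S` cannot be separated from `Z`, then `Z` uses all combinations of labels of `S`. -/
lemma exists_lab_eq {S : Finset (Fin k)} (hS : ¬ Separates D Z O lab S)
    (hne : ∀ x ∈ D, (labels S (O x)).Nonempty) {x y : α} (hxy : x ≠ y) {s t : Fin k × Fin k}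
    (hs : s ∈ labels S (O x)) (ht : t ∈ labels S (O y)) (hx : x ∈ D) (hy : y ∈ D) :
    ∃ z ∈ Z, lab z x = s ∧ lab z y = t := by
  classical
  have : Nonempty (Fin k × Fin k) := ⟨t⟩
  choose! τ hτ using hne
  by_contra! hcon
  refine hS ⟨fun u => if u = x then s else if u = y then t else τ u, fun u hu => ?_, fun z hz => ?_⟩
  · by_cases h : u = x
    · subst h; simpa using hs
    · by_cases h' : u = y
      · subst h'; simpa [h] using ht
      · simpa [h, h'] using hτ u hu
  · by_cases h : lab z x = s
    · exact ⟨y, hy, by simpa [hxy.symm] using (hcon z hz h).symm⟩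
    · exact ⟨x, hx, by simpa using Ne.symm h⟩

lemma card_labels_mul_le {S : Finset (Fin k)} (hS : ¬ Separates D Z O lab S)
    (hne : ∀ x ∈ D, (labels S (O x)).Nonempty) {x y : α} (hxy : x ≠ y) (hx : x ∈ D) (hy : y ∈ D) :
    (labels S (O x)).card * (labels S (O y)).card ≤ Z.card := by
  rw [← Finset.card_product]
  refine (Finset.card_le_card (t := Z.image fun z => (lab z x, lab z y)) fun st hst => ?_).trans
    Finset.card_image_le
  obtain ⟨hs, ht⟩ := Finset.mem_product.1 hst
  obtain ⟨z, hz, h1, h2⟩ := exists_lab_eq hS hne hxy hs ht hx hy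
  exact Finset.mem_image.2 ⟨z, hz, Prod.ext h1 h2⟩

lemma card_exchange_le {A : Finset (Finset (Fin k))} (hA : ∀ S ∈ A, ¬ Separates D Z O lab S)
    (hAp : ∀ S ∈ A, S.card = p) (hO : ∀ x ∈ D, (O x).card = p)
    (hne : ∀ S ∈ A, ∀ x ∈ D, (labels S (O x)).Nonempty) {x : α} (hx : x ∈ D) :
    (A.filter fun S => (S \ O x).card = 1).card ≤ Z.card := by
  refine (Finset.card_le_card (t := Z.image fun z => exchange (O x) (lab z x))
    fun S hS => ?_).trans Finset.card_image_le
  obtain ⟨hSA, h1⟩ := Finset.mem_filter.1 hS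
  obtain ⟨t, ht⟩ := hne S hSA x hx
  have h : ∃ z ∈ Z, lab z x = t := by
    by_contra! h
    exact hA S hSA (exists_separates_of_label (hne S hSA) hx ht fun z hz e => h z hz e.symm)
  obtain ⟨z, hz, rfl⟩ := h
  exact Finset.mem_image.2
    ⟨z, hz, (exchange_eq ((hAp S hSA).trans (hO x hx).symm) h1 ht).symm⟩

/-- Of two members of `D`, one is an exchange away from a set `S` that cannot be separated. -/
lemma card_mul_pred_le {A : Finset (Finset (Fin k))} (hA : ∀ S ∈ A, ¬ Separates D Z O lab S)
    (hAp : ∀ S ∈ A, S.card = p) (hO : ∀ x ∈ D, (O x).card = p)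
    (hne : ∀ S ∈ A, ∀ x ∈ D, (labels S (O x)).Nonempty) (hZ : Z.card < 16) :
    A.card * (D.card - 1) ≤ D.card * Z.card := by
  have h1 : ∀ S ∈ A, D.card - 1 ≤ (D.filter fun x => (S \ O x).card = 1).card := by
    intro S hS
    have : (D.filter fun x => ¬ (S \ O x).card = 1).card ≤ 1 := by
      rw [Finset.card_le_one]
      intro x hx y hy
      by_contra hxy
      obtain ⟨hxD, hx1⟩ := Finset.mem_filter.1 hx
      obtain ⟨hyD, hy1⟩ := Finset.mem_filter.1 hy
      have h := card_labels_mul_le (hA S hS) (hne S hS) hxy hxD hyD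
      have px := (hne S hS x hxD).card_pos
      have py := (hne S hS y hyD).card_pos
      rw [card_labels ((hAp S hS).trans (hO x hxD).symm)] at h px
      rw [card_labels ((hAp S hS).trans (hO y hyD).symm)] at h py
      have px' := Nat.pos_of_mul_pos_left px
      have py' := Nat.pos_of_mul_pos_left py
      have a2 : 2 ≤ (S \ O x).card := by omega
      have b2 : 2 ≤ (S \ O y).card := by omega
      have := Nat.mul_le_mul (Nat.mul_le_mul a2 a2) (Nat.mul_le_mul b2 b2)
      omega
    have h2 := Finset.card_filter_add_card_filter_not (s := D) (fun x => (S \ O x).card = 1)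
    omega
  calc A.card * (D.card - 1) = ∑ S ∈ A, (D.card - 1) := by simp
    _ ≤ ∑ S ∈ A, (D.filter fun x => (S \ O x).card = 1).card := Finset.sum_le_sum h1
    _ = ∑ x ∈ D, (A.filter fun S => (S \ O x).card = 1).card :=
        Finset.sum_card_bipartiteAbove_eq_sum_card_bipartiteBelow
          (fun (S : Finset (Fin k)) (x : α) => (S \ O x).card = 1)
    _ ≤ ∑ x ∈ D, Z.card := Finset.sum_le_sum fun x hx => card_exchange_le hA hAp hO hne hx
    _ = D.card * Z.card := by simp

end Exchange

section ExchangeStep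

variable {α : Type*} {p : ℕ} {D Z : Finset α} {O : α → Finset (Fin k)}
  {lab : α → α → Fin k × Fin k} {E : Finset (Finset (Fin k))}

lemma exists_separates_of_eight_le {m : ℕ} (hk : 8 ≤ k) (hD : D.Nonempty)
    (hO : ∀ x ∈ D, (O x).card = k / 2) (hE : E.card ≤ m + 1)
    (hDm : D.card + m ≤ k / 2 * (k - k / 2)) (hZm : Z.card + m + 2 ≤ k / 2 * (k - k / 2)) :
    ∃ S : Finset (Fin k), S.card = k / 2 ∧ S ∉ E ∧ (∀ x ∈ D, S ≠ O x) ∧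
      Separates D Z O lab S := by
  obtain ⟨v, hv⟩ := hD
  obtain ⟨t, h1, h2, -, hZ⟩ := exists_exchange (Z := Z) (f := fun z => lab z v) (E := ∅) (hO v hv)
    (by simp only [Finset.card_empty]; omega)
  have hcard := choose_le_card_separating (k := k) (p := k / 2) (t := t) (by omega)
    (fun e => h1 (e ▸ h2))
  have hchoose := mul_add_two_le_choose hk
  have hun : (E ∪ D.image O).card ≤ m + 1 + D.card :=
    (Finset.card_union_le _ _).trans (add_le_add hE Finset.card_image_le)
  obtain ⟨S, hS, hSE⟩ := Finset.exists_mem_notMem_of_card_lt_card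
    (hun.trans_lt (lt_of_lt_of_le (by omega) hcard))
  simp only [Finset.mem_filter, Finset.mem_powersetCard_univ] at hS
  simp only [Finset.mem_union, Finset.mem_image, not_or, not_exists, not_and] at hSE
  have hne : ∀ x ∈ D, S ≠ O x := fun x hx e => hSE.2 x hx e.symm
  exact ⟨S, hS.1, hSE.1, hne, exists_separates_of_label
    (fun x hx => labels_nonempty (hS.1.trans (hO x hx).symm) (hne x hx)) hv
    (mem_labels.2 ⟨⟨hS.2.1, h1⟩, h2, hS.2.2⟩) hZ⟩

lemma exists_separates_of_card_eq_one {m : ℕ} (hD : D.card = 1)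
    (hO : ∀ x ∈ D, (O x).card = p) (hE : E.card ≤ m + 1)
    (hZm : Z.card + m + 2 ≤ p * (k - p)) :
    ∃ S : Finset (Fin k), S.card = p ∧ S ∉ E ∧ (∀ x ∈ D, S ≠ O x) ∧
      Separates D Z O lab S := by
  obtain ⟨v, rfl⟩ := Finset.card_eq_one.1 hD
  have hOv : (O v).card = p := hO v (by simp)
  obtain ⟨t, h1, h2, hE, hZ⟩ := exists_exchange (Z := Z) (f := fun z => lab z v) (E := E) hOv
    (by omega)
  have hl := mem_labels_exchange h1 h2
  refine ⟨exchange (O v) t, (card_exchange h1 h2).trans hOv, hE, ?_,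
    exists_separates_of_label ?_ (by simp) hl hZ⟩
  · simp only [Finset.mem_singleton, forall_eq]
    intro e
    rw [mem_labels, e] at hl
    exact hl.1.2 hl.1.1
  · simpa using ⟨t, hl⟩

/-- The `p`-sets outside `E` that can be placed next to `D`. -/
def candidates (p : ℕ) (D : Finset α) (O : α → Finset (Fin k)) (E : Finset (Finset (Fin k))) :
    Finset (Finset (Fin k)) :=
  Finset.powersetCard p Finset.univ \ (E ∪ D.image O)

lemma mem_candidates {S : Finset (Fin k)} :
    S ∈ candidates p D O E ↔ S.card = p ∧ S ∉ E ∧ ∀ x ∈ D, S ≠ O x := by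
  simp [candidates, Finset.mem_powersetCard, eq_comm]

lemma choose_le_card_candidates :
    k.choose p ≤ (candidates p D O E).card + E.card + (D.image O).card := by
  have h1 := Finset.le_card_sdiff (E ∪ D.image O) (Finset.powersetCard p (Finset.univ : Finset (Fin k)))
  have h2 := Finset.card_union_le E (D.image O)
  rw [Finset.card_powersetCard, Finset.card_fin] at h1
  rw [candidates]
  omega

lemma exists_separates_of_five {D Z : Finset α} {O : α → Finset (Fin 5)}
    {lab : α → α → Fin 5 × Fin 5} {E : Finset (Finset (Fin 5))} {m : ℕ} (hD : 2 ≤ D.card)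
    (hO : ∀ x ∈ D, (O x).card = 2) (hE : E.card ≤ m + 1)
    (hDm : D.card + m ≤ 6) (hZm : Z.card + m + 2 ≤ 6) :
    ∃ S ∈ candidates 2 D O E, Separates D Z O lab S := by
  classical
  by_contra! hA
  have hAc := choose_le_card_candidates (p := 2) (D := D) (O := O) (E := E)
  have hc5 : Nat.choose 5 2 = 10 := by decide
  have him : (D.image O).card ≤ D.card := Finset.card_image_le
  have hAp : ∀ S ∈ candidates 2 D O E, S.card = 2 := fun S hS => (mem_candidates.1 hS).1
  have hne : ∀ S ∈ candidates 2 D O E, ∀ x ∈ D, (labels S (O x)).Nonempty := fun S hS x hx =>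
    labels_nonempty ((hAp S hS).trans (hO x hx).symm) ((mem_candidates.1 hS).2.2 x hx)
  by_cases hall : ∀ S ∈ candidates 2 D O E, ∀ x ∈ D, (S \ O x).card = 1
  · obtain ⟨x, hx⟩ : D.Nonempty := Finset.card_pos.1 (by omega)
    have h1 := card_exchange_le hA hAp hO hne hx
    rw [Finset.filter_true_of_mem fun S hS => hall S hS x hx] at h1
    obtain ⟨S₁, hS₁, S₂, hS₂, h12⟩ := Finset.one_lt_card.1
      (show 1 < (candidates 2 D O E).card by omega)
    have h2 := card_common_exchange_le (hAp S₁ hS₁) (hAp S₂ hS₂) h12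
    have h3 : (D.image O).card ≤ 4 := (Finset.card_le_card fun X hX => by
      obtain ⟨y, hy, rfl⟩ := Finset.mem_image.1 hX
      simp [Finset.mem_powersetCard, hO y hy, hall S₁ hS₁ y hy, hall S₂ hS₂ y hy]).trans h2
    omega
  · push Not at hall
    obtain ⟨S, hS, v, hv, hSv⟩ := hall
    obtain ⟨w, hw, hwv⟩ := Finset.exists_mem_ne (show 1 < D.card by omega) v
    have hmul := card_labels_mul_le (hA S hS) (hne S hS) hwv.symm hv hw
    have pv := (hne S hS v hv).card_pos
    obtain ⟨l, hl⟩ := hne S hS w hw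
    have pw := (hne S hS w hw).card_pos
    have cv := card_labels ((hAp S hS).trans (hO v hv).symm)
    have cw := card_labels ((hAp S hS).trans (hO w hw).symm)
    have h4 : 4 ≤ (labels S (O v)).card := by
      rw [cv] at pv ⊢
      have := Nat.pos_of_mul_pos_left pv
      exact Nat.mul_le_mul (show 2 ≤ _ by omega) (show 2 ≤ _ by omega)
    have hw1 : (labels S (O w)).card = 1 := by nlinarith
    have hw1' : (S \ O w).card = 1 := by
      rw [cw] at hw1; exact Nat.eq_one_of_mul_eq_one_left hw1
    obtain ⟨S', hS', hSS'⟩ := Finset.exists_mem_ne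
      (show 1 < (candidates 2 D O E).card by omega) S
    obtain ⟨t, ht, htl⟩ : ∃ t ∈ labels S' (O w), t ≠ l := by
      by_contra! h
      obtain ⟨t, ht⟩ := hne S' hS' w hw
      have hsing : labels S' (O w) = {l} := Finset.eq_singleton_iff_unique_mem.2
        ⟨h t ht ▸ ht, h⟩
      have c' := card_labels ((hAp S' hS').trans (hO w hw).symm)
      rw [hsing, Finset.card_singleton] at c'
      have c1 : (S' \ O w).card = 1 := Nat.eq_one_of_mul_eq_one_left c'.symm
      apply hSS'
      rw [exchange_eq ((hAp S hS).trans (hO w hw).symm) hw1' hl,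
        exchange_eq ((hAp S' hS').trans (hO w hw).symm) c1 (t := l) (by rw [hsing]; simp)]
    obtain ⟨s, hs⟩ := hne S' hS' v hv
    obtain ⟨z', hz', -, hz'w⟩ := exists_lab_eq (hA S' hS') (hne S' hS') hwv.symm hs ht hv hw
    have hsub : labels S (O v) ⊆ (Z.erase z').image fun z => lab z v := by
      intro u hu
      obtain ⟨z, hz, h1, h2⟩ := exists_lab_eq (hA S hS) (hne S hS) hwv.symm hu hl hv hw
      refine Finset.mem_image.2 ⟨z, Finset.mem_erase.2 ⟨?_, hz⟩, h1⟩
      rintro rfl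
      exact htl (hz'w.symm.trans h2)
    have := (Finset.card_le_card hsub).trans Finset.card_image_le
    rw [Finset.card_erase_of_mem hz'] at this
    omega

/-- The local step of the construction with out-sets of size `k / 2`. -/
lemma exists_separates {m : ℕ} (hk : 5 ≤ k) (hD : D.Nonempty)
    (hO : ∀ x ∈ D, (O x).card = k / 2) (hE : E.card ≤ m + 1)
    (hDm : D.card + m ≤ k / 2 * (k - k / 2)) (hZm : Z.card + m + 2 ≤ k / 2 * (k - k / 2)) :
    ∃ S : Finset (Fin k), S.card = k / 2 ∧ S ∉ E ∧ (∀ x ∈ D, S ≠ O x) ∧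
      Separates D Z O lab S := by
  rcases le_or_gt 8 k with hk8 | hk8
  · exact exists_separates_of_eight_le hk8 hD hO hE hDm hZm
  rcases (show 1 ≤ D.card from hD.card_pos).eq_or_lt with hD1 | hD2
  · exact exists_separates_of_card_eq_one hD1.symm hO hE hZm
  suffices h : ∃ S ∈ candidates (k / 2) D O E, Separates D Z O lab S by
    obtain ⟨S, hS, hsep⟩ := h
    obtain ⟨h1, h2, h3⟩ := mem_candidates.1 hS
    exact ⟨S, h1, h2, h3, hsep⟩
  by_cases hk5 : k = 5
  · subst hk5
    exact exists_separates_of_five hD2 hO hE hDm hZm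
  by_contra! hA
  have hAc := choose_le_card_candidates (p := k / 2) (D := D) (O := O) (E := E)
  have him : (D.image O).card ≤ D.card := Finset.card_image_le
  have hAp : ∀ S ∈ candidates (k / 2) D O E, S.card = k / 2 :=
    fun S hS => (mem_candidates.1 hS).1
  have hmul := card_mul_pred_le hA hAp hO (fun S hS x hx =>
    labels_nonempty ((hAp S hS).trans (hO x hx).symm) ((mem_candidates.1 hS).2.2 x hx))
    (by interval_cases k <;> omega)
  generalize (candidates (k / 2) D O E).card = a at *
  generalize D.card = d at *
  generalize Z.card = n at *
  obtain ⟨d, rfl⟩ : ∃ e, d = e + 1 := ⟨d - 1, by omega⟩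
  rw [Nat.add_sub_cancel] at hmul
  obtain rfl | rfl : k = 6 ∨ k = 7 := by omega
  · have h20 : Nat.choose 6 (6 / 2) = 20 := by decide
    have hd : d ≤ 8 := by omega
    interval_cases d <;> omega
  · have h35 : Nat.choose 7 (7 / 2) = 35 := by decide
    have hd : d ≤ 11 := by omega
    interval_cases d <;> omega

end ExchangeStep

end Labels
lemma swap_mem_labels {k : ℕ} {S X : Finset (Fin k)} {t : Fin k × Fin k} :
    t.swap ∈ labels S X ↔ t ∈ labels X S := by
  simp only [mem_labels, Prod.fst_swap, Prod.snd_swap]; tauto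

/-- The degrees seen by a step of the construction. -/
lemma card_neighbors_add_le {V : Type*} [DecidableEq V] {G : SimpleGraph V} [DecidableRel G.Adj]
    {Δ : ℕ} (hΔ : ∀ x (s : Finset V), (∀ y ∈ s, G.Adj x y) → s.card ≤ Δ) (T B : Finset V) (w : V) :
    (T.filter (G.Adj w)).card + ((B \ T).filter (G.Adj w)).card ≤ Δ := by
  rw [← Finset.card_union_of_disjoint
    (Finset.disjoint_filter_filter Finset.disjoint_sdiff)]
  refine hΔ w _ fun y hy => ?_
  rw [← Finset.filter_union] at hy
  exact (Finset.mem_filter.1 hy).2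

/-- The construction with all out-sets of size `k / 2`, the one of the root being used only once. -/
theorem exists_colouring_of_exchange {V : Type*} [Fintype V] [DecidableEq V] {G : SimpleGraph V}
    (hconn : G.Connected) {Δ k : ℕ}
    (hΔ : ∀ x (s : Finset V), (∀ y ∈ s, G.Adj x y) → s.card ≤ Δ) {r : V} {N : Finset V}
    (hN : ∀ x, x ∈ N ↔ G.Adj r x) (hNΔ : N.card = Δ) (hpos : 0 < Δ) (hk : 2 ≤ k)
    (hk' : Δ ≤ 1 ∨ 5 ≤ k) (hpq : Δ ≤ k / 2 * (k - k / 2)) (hpΔ : k / 2 ≤ Δ) :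
    ∃ c : V → V → Fin k, IsTypeIColouring G c ∧ IsDistinguishing G c := by
  classical
  obtain ⟨P, -, hP⟩ := Finset.exists_subset_card_eq (s := (Finset.univ : Finset (Fin k)))
    (n := k / 2) (by simp; omega)
  obtain ⟨q₀, hq₀⟩ : ∃ q, q ∉ P := by
    by_contra! h
    rw [Finset.eq_univ_iff_forall.2 h, Finset.card_fin] at hP
    omega
  obtain ⟨X, hX1, hX2, hXc⟩ := Finset.exists_subsuperset_card_eq (s := P ×ˢ {q₀}) (t := P ×ˢ Pᶜ)
    (n := Δ) (Finset.product_subset_product_right (by simpa using hq₀))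
    (by simpa [hP] using hpΔ) (by simpa [hP, Finset.card_compl] using hpq)
  have hne : Nonempty (Fin k × Fin k) := ⟨(q₀, q₀)⟩
  obtain ⟨ι, hιm, hιi, hιs⟩ := N.finite_toSet.exists_bijOn_of_encard_eq
    (t := (X : Set (Fin k × Fin k))) (by simp [hNΔ, hXc])
  have hιP : ∀ w ∈ N, (ι w).1 ∈ P ∧ (ι w).2 ∉ P := fun w hw => by
    simpa using hX2 (hιm hw)
  have hrN : ∀ w ∈ N, w ≠ r := fun w hw e => G.irrefl (e ▸ (hN w).1 hw)
  let O₀ : V → Finset (Fin k) := fun x => if x = r then P else exchange P (ι x).swap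
  have hOr : O₀ r = P := by simp [O₀]
  have hON : ∀ w ∈ N, O₀ w = exchange P (ι w).swap := fun w hw => by simp [O₀, hrN w hw]
  have hcard : ∀ x ∈ insert r N, (O₀ x).card = k / 2 := by
    intro x hx
    rcases Finset.mem_insert.1 hx with rfl | hx
    · rw [hOr, hP]
    · rw [hON x hx, card_exchange (hιP x hx).2 (hιP x hx).1, hP]
  have hι : ∀ w ∈ N, ι w ∈ labels (O₀ r) (O₀ w) := fun w hw => by
    rw [hOr, hON w hw, ← swap_mem_labels]
    exact mem_labels_exchange (hιP w hw).2 (hιP w hw).1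
  obtain ⟨c₀, hc₀, hresp, hrig⟩ := exists_rigid_star hN hιi hι fun w hw w' hw' hww' => by
    have hOne : O₀ w ≠ O₀ w' := fun e => by
      rw [hON w hw, hON w' hw'] at e
      exact hww'.ne (hιi hw hw' (Prod.swap_injective (exchange_injOn P
        (by simpa using (hιP w hw).symm) (by simpa using (hιP w' hw').symm) e)))
    obtain ⟨t, ht⟩ := labels_nonempty ((hcard w (Finset.mem_insert_of_mem hw)).trans
      (hcard w' (Finset.mem_insert_of_mem hw')).symm) hOne
    exact ⟨t.1, (mem_labels.1 ht).1⟩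
  let Inv : Finset V → (V → Finset (Fin k)) → (V → V → Fin k) → Prop := fun B O c =>
    insert r N ⊆ B ∧ (∀ x ∈ B, (O x).card = k / 2) ∧ O r = P ∧ (∀ x ∈ B, x ≠ r → O x ≠ P) ∧
      ∀ a ∈ P, ∃ u ∈ N, c r u = a
  have hex : ∃ (O : V → Finset (Fin k)) (c : V → V → Fin k), RespectsOn G O c Finset.univ ∧
      Inv Finset.univ O c ∧ RigidOn G c r Finset.univ := by
    refine exists_rigid_colouring hconn Inv (Finset.mem_insert_self r N) ?_ hresp hrig ?_ ?_ ?_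
    · have hNe : N.Nonempty := Finset.card_pos.1 (by omega)
      intro x hx
      rcases Finset.mem_insert.1 hx with rfl | hx
      · obtain ⟨y, hy⟩ := hNe
        exact ⟨y, Finset.mem_insert_of_mem hy, (hN y).1 hy⟩
      · exact ⟨r, Finset.mem_insert_self _ _, ((hN x).1 hx).symm⟩
    · refine ⟨subset_rfl, hcard, hOr, fun x hx hxr e => ?_, fun a ha => ?_⟩
      · have hxN := Finset.mem_of_mem_insert_of_ne hx hxr
        have := mem_labels.1 (hι x hxN)
        rw [e, hOr] at this
        exact this.1.2 this.1.1
      · obtain ⟨u, hu, he⟩ := hιs (hX1 (show (a, q₀) ∈ _ by simpa using ha))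
        exact ⟨u, hu, by rw [(hc₀ u hu).1, he]⟩
    · rintro T O c O' c' ⟨h1, h2, h3, h4, h5⟩ hO hc
      have hrT := h1 (Finset.mem_insert_self _ _)
      refine ⟨h1, fun x hx => by rw [hO x hx, h2 x hx], by rw [hO r hrT, h3],
        fun x hx hxr => by rw [hO x hx]; exact h4 x hx hxr, fun a ha => ?_⟩
      obtain ⟨u, hu, he⟩ := h5 a ha
      exact ⟨u, hu, by rw [hc r hrT u (h1 (Finset.mem_insert_of_mem hu)), he]⟩
    · rintro T B O c w - hTB - - ⟨h1, h2, h3, h4, h5⟩ hwB ⟨v, hvT, hwv⟩ htw hTn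
      obtain ⟨y, hy, hvy⟩ := hTn v hvT
      have htwins := card_twins_le hΔ (s := {y}) hTB hwB hvT hwv htw (by simpa using hy)
        (by simpa using hvy)
      have hdeg := card_neighbors_add_le hΔ T B w
      have hYZ := Finset.card_filter_add_card_filter_not (s := B \ T) (G.Adj w)
      rw [Finset.card_singleton] at htwins
      have hk5 : 5 ≤ k := hk'.resolve_left (by omega)
      have hE : (insert P (((B \ T).filter (G.Adj w)).image O)).card ≤
          ((B \ T).filter (G.Adj w)).card + 1 :=
        (Finset.card_insert_le _ _).trans (by gcongr; exact Finset.card_image_le)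
      obtain ⟨S, hS, hSE, hSO, τ, hτ, hτZ⟩ := exists_separates (D := T.filter (G.Adj w))
        (Z := (B \ T).filter fun z => ¬ G.Adj w z) (O := O) (lab := fun z x => (c z x, c x z)) hk5
        ⟨v, by simp [hvT, hwv]⟩ (fun x hx => h2 x (hTB (Finset.mem_filter.1 hx).1)) hE
        (by omega) (by omega)
      have hSne : ∀ x ∈ B, G.Adj w x → S ≠ O x := by
        intro x hx hwx
        by_cases hxT : x ∈ T
        · exact hSO x (by simp [hxT, hwx])
        · rintro rfl
          exact hSE (Finset.mem_insert_of_mem (Finset.mem_image_of_mem O (by simp [hx, hxT, hwx])))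
      have hlab : ∀ x ∈ B, G.Adj w x → ∃ t, t ∈ labels S (O x) := fun x hx hwx =>
        labels_nonempty (hS.trans (h2 x hx).symm) (hSne x hx hwx)
      choose! σ hσ using hlab
      have hne : ∀ x ∈ B, x ≠ w := fun x hx e => hwB (e ▸ hx)
      have hrB := h1 (Finset.mem_insert_self _ _)
      refine ⟨S, fun x => if x ∈ T then τ x else σ x, fun x hx hwx => ?_, fun z hz hzT hwz => ?_,
        h1.trans (Finset.subset_insert _ _), fun x hx => ?_, ?_, fun x hx hxr => ?_, fun a ha => ?_⟩
      · by_cases hxT : x ∈ T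
        · simpa [hxT] using hτ x (by simp [hxT, hwx])
        · simpa [hxT] using hσ x hx hwx
      · obtain ⟨x, hx, hl⟩ := hτZ z (by simp [hz, hzT, hwz])
        obtain ⟨hxT, hwx⟩ := Finset.mem_filter.1 hx
        exact ⟨x, hxT, hwx, by simpa [hxT] using hl⟩
      · rcases Finset.mem_insert.1 hx with rfl | hxB
        · simpa using hS
        · simpa [hne x hxB] using h2 x hxB
      · simpa [hne r hrB] using h3
      · rcases Finset.mem_insert.1 hx with rfl | hxB
        · simp only [Function.update_self]
          rintro rfl
          exact hSE (Finset.mem_insert_self _ _)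
        · simpa [hne x hxB] using h4 x hxB hxr
      · obtain ⟨u, hu, he⟩ := h5 a ha
        exact ⟨u, hu, by
          rw [extendArcs_of_ne _ _ _ (hne r hrB) (hne u (h1 (Finset.mem_insert_of_mem hu))), he]⟩
  obtain ⟨O, c, hR, ⟨-, hcO, hOr', hOP, hPN⟩, hrigid⟩ := hex
  refine ⟨c, hR.isTypeI (by simp), fun φ hφ => ?_⟩
  have hr : φ r = r := by
    by_contra hr
    refine hOP (φ r) (by simp) hr (Finset.eq_of_subset_of_card_le (fun a ha => ?_) ?_).symm
    · obtain ⟨u, hu, rfl⟩ := hPN a ha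
      have hru := (hN u).1 hu
      rw [← hφ r u hru]
      exact (hR _ (by simp) _ (by simp) (φ.map_adj_iff.2 hru)).1
    · rw [hP, hcO _ (by simp)]
  exact fun x => hrigid c (fun _ _ _ _ _ => rfl) (hR.isTypeI (by simp)) φ hφ hr x (by simp)
section FourColours

/-- The lower half of the four colours. -/
def lo : Finset (Fin 4) := {0, 1}

/-- The upper half of the four colours. -/
def hi : Finset (Fin 4) := {2, 3}

lemma lo_ne_hi : lo ≠ hi := by decide

lemma card_lo : lo.card = 2 := by decide

lemma card_hi : hi.card = 2 := by decide

lemma notMem_hi_iff {a : Fin 4} : a ∉ hi ↔ a ∈ lo := by revert a; decide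

lemma notMem_lo_iff {a : Fin 4} : a ∉ lo ↔ a ∈ hi := by revert a; decide

lemma exchange_lo_ne {t : Fin 4 × Fin 4} (h1 : t.1 ∉ lo) (h2 : t.2 ∈ lo) :
    exchange lo t ≠ lo ∧ exchange lo t ≠ hi := by
  revert t; decide

lemma card_labels_lo_hi : (labels lo hi).card = 4 := by decide

lemma card_labels_hi_lo : (labels hi lo).card = 4 := by decide

lemma card_crossing :
    ((Finset.powersetCard 2 Finset.univ).filter fun S => S ≠ lo ∧ S ≠ hi).card = 4 := by
  decide

lemma card_crossing_sdiff {S X : Finset (Fin 4)} (hS : S.card = 2) (hlo : S ≠ lo) (hhi : S ≠ hi)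
    (hX : X = lo ∨ X = hi) : (S \ X).card = 1 := by
  rcases hX with rfl | rfl <;> revert S <;> decide

/-- The labels of `S` towards `X` that do not put `l` on an arc from `lo` to `hi`. -/
def avoiding (l : Fin 4 × Fin 4) (S X : Finset (Fin 4)) : Finset (Fin 4 × Fin 4) :=
  (labels S X).filter fun t => (S = lo → X = hi → t ≠ l) ∧ (S = hi → X = lo → t ≠ l.swap)

variable {l : Fin 4 × Fin 4} {S X : Finset (Fin 4)}

lemma mem_avoiding {t : Fin 4 × Fin 4} : t ∈ avoiding l S X ↔ t ∈ labels S X ∧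
    (S = lo → X = hi → t ≠ l) ∧ (S = hi → X = lo → t ≠ l.swap) := by
  simp [avoiding]

lemma three_le_card_avoiding (h : (S = lo ∧ X = hi) ∨ (S = hi ∧ X = lo)) :
    3 ≤ (avoiding l S X).card := by
  obtain ⟨u, hu, h4⟩ : ∃ u, (labels S X).erase u ⊆ avoiding l S X ∧ (labels S X).card = 4 := by
    rcases h with ⟨rfl, rfl⟩ | ⟨rfl, rfl⟩
    · refine ⟨l, fun t ht => ?_, card_labels_lo_hi⟩
      rw [Finset.mem_erase] at ht
      simp [mem_avoiding, ht, lo_ne_hi]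
    · refine ⟨l.swap, fun t ht => ?_, card_labels_hi_lo⟩
      rw [Finset.mem_erase] at ht
      simp [mem_avoiding, ht, lo_ne_hi.symm]
  have h1 := Finset.card_le_card hu
  have h2 := Finset.pred_card_le_card_erase (s := labels S X) (a := u)
  omega

lemma avoiding_nonempty (hc : S.card = X.card) (hne : S ≠ X) : (avoiding l S X).Nonempty := by
  by_cases h : (S = lo ∧ X = hi) ∨ (S = hi ∧ X = lo)
  · exact Finset.card_pos.1 (by have := three_le_card_avoiding (l := l) h; omega)
  · obtain ⟨t, ht⟩ := labels_nonempty hc hne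
    exact ⟨t, mem_avoiding.2 ⟨ht, fun h1 h2 => (h (.inl ⟨h1, h2⟩)).elim,
      fun h1 h2 => (h (.inr ⟨h1, h2⟩)).elim⟩⟩

variable {α : Type*} {D Y Z : Finset α} {O : α → Finset (Fin 4)} {lab : α → α → Fin 4 × Fin 4}

/-- `S` fits next to `D ∪ Y` and is separated from `Z` at a vertex of `D`; it is different from
`lo` and `hi` only if both occur next to it. -/
def AxisStep [DecidableEq α] (l : Fin 4 × Fin 4) (D Y Z : Finset α) (O : α → Finset (Fin 4))
    (lab : α → α → Fin 4 × Fin 4) (S : Finset (Fin 4)) : Prop :=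
  S.card = 2 ∧ (∀ x ∈ D ∪ Y, S ≠ O x) ∧
    (S ≠ lo → S ≠ hi → (∃ x ∈ D ∪ Y, O x = lo) ∧ ∃ x ∈ D ∪ Y, O x = hi) ∧
    ∃ v ∈ D, ∃ t ∈ avoiding l S (O v), ∀ z ∈ Z, t ≠ lab z v

lemma axisStep_of_axis [DecidableEq α] (hS : S = lo ∨ S = hi) (hSO : ∀ x ∈ D ∪ Y, S ≠ O x)
    (h : ∃ v ∈ D, ∃ t ∈ avoiding l S (O v), ∀ z ∈ Z, t ≠ lab z v) :
    AxisStep l D Y Z O lab S := by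
  refine ⟨?_, hSO, fun h1 h2 => (hS.elim h1 h2).elim, h⟩
  rcases hS with rfl | rfl
  exacts [card_lo, card_hi]

lemma axisStep_of_opposite [DecidableEq α] {v : α} (hv : v ∈ D)
    (h : (S = lo ∧ O v = hi) ∨ (S = hi ∧ O v = lo)) (hSO : ∀ x ∈ D ∪ Y, S ≠ O x)
    (hZ : Z.card ≤ 2) : AxisStep l D Y Z O lab S := by
  refine axisStep_of_axis (h.imp And.left And.left) hSO ⟨v, hv, ?_⟩
  have h1 := three_le_card_avoiding (l := l) h
  have h2 : (Z.image fun z => lab z v).card ≤ Z.card := Finset.card_image_le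
  obtain ⟨t, ht, htZ⟩ := Finset.exists_mem_notMem_of_card_lt_card
    (s := Z.image fun z => lab z v) (t := avoiding l S (O v)) (by omega)
  exact ⟨t, ht, fun z hz e => htZ (Finset.mem_image.2 ⟨z, hz, e.symm⟩)⟩

/-- If both `lo` and `hi` occur next to the new vertex, a third set is chosen. -/
lemma exists_axisStep_crossing [DecidableEq α] (hD : D.Nonempty)
    (hO : ∀ x ∈ D ∪ Y, (O x).card = 2)
    (h2 : Y.card + Z.card ≤ 2) (h4 : D.card + Y.card ≤ 4)
    (hcross : ∀ x ∈ D, O x ≠ lo → O x ≠ hi → Y.card + Z.card ≤ 1)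
    (hlo : ∃ x ∈ D ∪ Y, O x = lo) (hhi : ∃ x ∈ D ∪ Y, O x = hi) :
    ∃ S, AxisStep l D Y Z O lab S := by
  obtain ⟨a, ha, hla⟩ := hlo
  obtain ⟨b, hb, hhb⟩ := hhi
  have hab : a ≠ b := fun e => lo_ne_hi (by rw [← hla, ← hhb, e])
  obtain ⟨v, hv, hvax⟩ : ∃ v ∈ D, O v = lo ∨ O v = hi := by
    by_contra! h
    have haY : a ∈ Y := (Finset.mem_union.1 ha).resolve_left fun h' => (h a h').1 hla
    have hbY : b ∈ Y := (Finset.mem_union.1 hb).resolve_left fun h' => (h b h').2 hhb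
    have h1 : 1 < Y.card := Finset.one_lt_card.2 ⟨a, haY, b, hbY, hab⟩
    obtain ⟨x, hx⟩ := hD
    have := hcross x hx (h x hx).1 (h x hx).2
    omega
  obtain ⟨W, hW, hWO⟩ : ∃ W : Finset α, W.card + Z.card ≤ 3 ∧
      ∀ x ∈ D ∪ Y, O x = lo ∨ O x = hi ∨ x ∈ W := by
    by_cases hD : ∃ x ∈ D, O x ≠ lo ∧ O x ≠ hi
    · obtain ⟨x, hx, hx1, hx2⟩ := hD
      have h1 := hcross x hx hx1 hx2
      refine ⟨((D ∪ Y).erase a).erase b, ?_, fun y hy => ?_⟩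
      · rw [Finset.card_erase_of_mem (Finset.mem_erase.2 ⟨hab.symm, hb⟩),
          Finset.card_erase_of_mem ha]
        have := Finset.card_union_le D Y
        omega
      · by_cases hya : y = a
        · exact .inl (hya ▸ hla)
        by_cases hyb : y = b
        · exact .inr (.inl (hyb ▸ hhb))
        · simp [hya, hyb, hy]
    · push Not at hD
      refine ⟨Y, by omega, fun y hy => ?_⟩
      rcases Finset.mem_union.1 hy with hy | hy
      · by_cases h : O y = lo
        · exact .inl h
        · exact .inr (.inl (hD y hy h))
      · exact .inr (.inr hy)
  have hF : (W.image O ∪ Z.image fun z => exchange (O v) (lab z v)).card ≤ 3 :=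
    ((Finset.card_union_le _ _).trans (add_le_add Finset.card_image_le Finset.card_image_le)).trans
      hW
  obtain ⟨S, hS, hSF⟩ := Finset.exists_mem_notMem_of_card_lt_card
    (hF.trans_lt (by rw [card_crossing]; norm_num))
  simp only [Finset.mem_filter, Finset.mem_powersetCard_univ] at hS
  obtain ⟨hS2, hS3, hS4⟩ := hS
  simp only [Finset.mem_union, Finset.mem_image, not_or, not_exists, not_and] at hSF
  have hSO : ∀ x ∈ D ∪ Y, S ≠ O x := by
    intro x hx
    rcases hWO x hx with h | h | h
    · rwa [h]
    · rwa [h]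
    · exact fun e => hSF.1 x h e.symm
  have hvu : v ∈ D ∪ Y := Finset.mem_union_left _ hv
  have hcard := hS2.trans (hO v hvu).symm
  obtain ⟨t, ht⟩ := avoiding_nonempty (l := l) hcard (hSO v hvu)
  refine ⟨S, hS2, hSO, fun _ _ => ⟨⟨a, ha, hla⟩, b, hb, hhb⟩, v, hv, t, ht, fun z hz e => ?_⟩
  exact hSF.2 z hz (e ▸ (exchange_eq hcard (card_crossing_sdiff hS2 hS3 hS4 hvax)
    (mem_avoiding.1 ht).1).symm)

/-- The local step of the construction with four colours. -/
lemma exists_axisStep [DecidableEq α] (hD : D.Nonempty) (hO : ∀ x ∈ D ∪ Y, (O x).card = 2)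
    (h2 : Y.card + Z.card ≤ 2) (h4 : D.card + Y.card ≤ 4)
    (hcross : ∀ x ∈ D, O x ≠ lo → O x ≠ hi → Y.card + Z.card ≤ 1) :
    ∃ S, AxisStep l D Y Z O lab S := by
  by_cases hboth : (∃ x ∈ D ∪ Y, O x = lo) ∧ ∃ x ∈ D ∪ Y, O x = hi
  · exact exists_axisStep_crossing hD hO h2 h4 hcross hboth.1 hboth.2
  by_cases hl : ∃ v ∈ D, O v = lo
  · obtain ⟨v, hv, hvl⟩ := hl
    exact ⟨hi, axisStep_of_opposite hv (.inr ⟨rfl, hvl⟩) (fun x hx e =>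
      hboth ⟨⟨v, Finset.mem_union_left _ hv, hvl⟩, x, hx, e.symm⟩) (by omega)⟩
  by_cases hh : ∃ v ∈ D, O v = hi
  · obtain ⟨v, hv, hvh⟩ := hh
    exact ⟨lo, axisStep_of_opposite hv (.inl ⟨rfl, hvh⟩) (fun x hx e =>
      hboth ⟨⟨x, hx, e.symm⟩, v, Finset.mem_union_left _ hv, hvh⟩) (by omega)⟩
  push Not at hl hh
  obtain ⟨x, hx⟩ := hD
  have hle := hcross x hx (hl x hx) (hh x hx)
  have hOx := hO x (Finset.mem_union_left _ hx)
  rcases Z.eq_empty_or_nonempty with rfl | hZ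
  · obtain ⟨S, hS, hSO⟩ : ∃ S, (S = lo ∨ S = hi) ∧ ∀ x ∈ D ∪ Y, S ≠ O x := by
      by_contra! h
      obtain ⟨a, ha, hla⟩ := h lo (.inl rfl)
      obtain ⟨b, hb, hhb⟩ := h hi (.inr rfl)
      exact hboth ⟨⟨a, ha, hla.symm⟩, b, hb, hhb.symm⟩
    have hSc : S.card = 2 := by
      rcases hS with rfl | rfl
      exacts [card_lo, card_hi]
    obtain ⟨t, ht⟩ := avoiding_nonempty (l := l) (hSc.trans hOx.symm)
      (hSO x (Finset.mem_union_left _ hx))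
    exact ⟨S, axisStep_of_axis hS hSO ⟨x, hx, t, ht, by simp⟩⟩
  · have hZ1 := hZ.card_pos
    obtain ⟨z, rfl⟩ := Finset.card_eq_one.1 (show Z.card = 1 by omega)
    obtain rfl : Y = ∅ := Finset.card_eq_zero.1 (by omega)
    obtain ⟨S, hS, hzS⟩ : ∃ S, (S = lo ∨ S = hi) ∧ (lab z x).1 ∉ S := by
      by_cases h : (lab z x).1 ∈ lo
      · exact ⟨hi, .inr rfl, notMem_hi_iff.2 h⟩
      · exact ⟨lo, .inl rfl, h⟩
    have hSO : ∀ y ∈ D ∪ ∅, S ≠ O y := by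
      intro y hy
      rw [Finset.union_empty] at hy
      rcases hS with rfl | rfl
      exacts [(hl y hy).symm, (hh y hy).symm]
    have hSc : S.card = 2 := by
      rcases hS with rfl | rfl
      exacts [card_lo, card_hi]
    obtain ⟨t, ht⟩ := avoiding_nonempty (l := l) (hSc.trans hOx.symm)
      (hSO x (Finset.mem_union_left _ hx))
    refine ⟨S, axisStep_of_axis hS hSO ⟨x, hx, t, ht, fun z' hz' e => hzS ?_⟩⟩
    rw [Finset.mem_singleton.1 hz'] at e
    exact e ▸ (mem_labels.1 (mem_avoiding.1 ht).1).1.1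

/-- The construction with four colours, in which the out-sets `lo` and `hi` are preferred. -/
theorem exists_colouring_of_four {V : Type*} [Fintype V] [DecidableEq V] {G : SimpleGraph V}
    (hconn : G.Connected) (hΔ : ∀ x (s : Finset V), (∀ y ∈ s, G.Adj x y) → s.card ≤ 4)
    {r w₀ : V} (hrw : G.Adj r w₀) :
    ∃ c : V → V → Fin 4, IsTypeIColouring G c ∧ IsDistinguishing G c := by
  classical
  obtain ⟨N, hN⟩ : ∃ N : Finset V, ∀ x, x ∈ N ↔ G.Adj r x :=
    ⟨Finset.univ.filter (G.Adj r), by simp⟩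
  have hw₀ := (hN w₀).2 hrw
  obtain ⟨I, hwI, hI⟩ : ∃ I : Finset V, w₀ ∈ I ∧ Maximal
      (fun I : Finset V => I ⊆ N ∧ ∀ x ∈ I, ∀ y ∈ I, ¬ G.Adj x y) I := by
    obtain ⟨I, h1, h2⟩ := (Set.toFinite
      {I : Finset V | I ⊆ N ∧ ∀ x ∈ I, ∀ y ∈ I, ¬ G.Adj x y}).exists_le_maximal
      (a := {w₀}) (by simpa using hw₀)
    exact ⟨I, h1 (Finset.mem_singleton_self w₀), h2⟩
  obtain ⟨hIN, hIind⟩ := hI.prop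
  have hImax : ∀ x ∈ N, x ∉ I → ∃ y ∈ I, G.Adj x y := by
    intro x hx hxI
    by_contra! h
    refine hxI (hI.2 ⟨Finset.insert_subset hx hIN, ?_⟩ (Finset.subset_insert x I)
      (Finset.mem_insert_self x I))
    intro y hy z hz
    rcases Finset.mem_insert.1 hy with rfl | hyI <;> rcases Finset.mem_insert.1 hz with rfl | hzI
    · exact G.irrefl
    · exact h z hzI
    · exact fun hyz => h y hyI hyz.symm
    · exact hIind y hyI z hzI
  have hne : Nonempty (Fin 4 × Fin 4) := ⟨(0, 0)⟩
  obtain ⟨ι, hιm, hιi⟩ := N.finite_toSet.exists_injOn_of_encard_le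
    (t := ((lo ×ˢ hi : Finset _) : Set (Fin 4 × Fin 4))) (by
      rw [Set.encard_coe_eq_coe_finsetCard, Set.encard_coe_eq_coe_finsetCard, Finset.card_product]
      exact_mod_cast hΔ r N fun y hy => (hN y).1 hy)
  have hιP : ∀ w ∈ N, (ι w).1 ∈ lo ∧ (ι w).2 ∈ hi := fun w hw => by
    simpa using hιm hw
  have hrN : ∀ w ∈ N, w ≠ r := fun w hw e => G.irrefl (e ▸ (hN w).1 hw)
  let O₀ : V → Finset (Fin 4) := fun x =>
    if x = r then lo else if x ∈ I then hi else exchange lo (ι x).swap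
  have hOr : O₀ r = lo := by simp [O₀]
  have hOI : ∀ w ∈ I, O₀ w = hi := fun w hw => by simp [O₀, hrN w (hIN hw), hw]
  have hON : ∀ w ∈ N, w ∉ I → O₀ w = exchange lo (ι w).swap := fun w hw hwI => by
    simp [O₀, hrN w hw, hwI]
  have hOne : ∀ w ∈ N, w ∉ I → O₀ w ≠ lo ∧ O₀ w ≠ hi := fun w hw hwI => by
    rw [hON w hw hwI]
    exact exchange_lo_ne (notMem_lo_iff.2 (hιP w hw).2) (hιP w hw).1
  have hcard : ∀ x ∈ insert r N, (O₀ x).card = 2 := by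
    intro x hx
    rcases Finset.mem_insert.1 hx with rfl | hx
    · rw [hOr, card_lo]
    by_cases hxI : x ∈ I
    · rw [hOI x hxI, card_hi]
    · rw [hON x hx hxI, card_exchange (notMem_lo_iff.2 (hιP x hx).2) (hιP x hx).1, card_lo]
  have hι : ∀ w ∈ N, ι w ∈ labels (O₀ r) (O₀ w) := fun w hw => by
    by_cases hwI : w ∈ I
    · rw [hOr, hOI w hwI, mem_labels, notMem_hi_iff, notMem_lo_iff]
      exact ⟨⟨(hιP w hw).1, (hιP w hw).1⟩, (hιP w hw).2, (hιP w hw).2⟩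
    · rw [hOr, hON w hw hwI, ← swap_mem_labels]
      exact mem_labels_exchange (notMem_lo_iff.2 (hιP w hw).2) (hιP w hw).1
  obtain ⟨c₀, hc₀, hresp, hrig⟩ := exists_rigid_star hN hιi hι fun w hw w' hw' hww' => by
    have hOww' : O₀ w ≠ O₀ w' := fun e => by
      by_cases hwI : w ∈ I <;> by_cases hwI' : w' ∈ I
      · exact hIind w hwI w' hwI' hww'
      · exact (hOne w' hw' hwI').2 (by rw [← e, hOI w hwI])
      · exact (hOne w hw hwI).2 (by rw [e, hOI w' hwI'])
      · rw [hON w hw hwI, hON w' hw' hwI'] at e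
        exact hww'.ne (hιi hw hw' (Prod.swap_injective (exchange_injOn lo
          ⟨notMem_lo_iff.2 (hιP w hw).2, (hιP w hw).1⟩
          ⟨notMem_lo_iff.2 (hιP w' hw').2, (hιP w' hw').1⟩ e)))
    obtain ⟨t, ht⟩ := labels_nonempty ((hcard w (Finset.mem_insert_of_mem hw)).trans
      (hcard w' (Finset.mem_insert_of_mem hw')).symm) hOww'
    exact ⟨t.1, (mem_labels.1 ht).1⟩
  let Inv : Finset V → (V → Finset (Fin 4)) → (V → V → Fin 4) → Prop := fun B O c =>
    insert r N ⊆ B ∧ (∀ x ∈ B, (O x).card = 2) ∧ O r = lo ∧ O w₀ = hi ∧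
      (c r w₀, c w₀ r) = ι w₀ ∧
      (∀ x ∈ B, O x ≠ lo → O x ≠ hi →
        (∃ y ∈ B, G.Adj x y ∧ O y = lo) ∧ ∃ y ∈ B, G.Adj x y ∧ O y = hi) ∧
      ∀ u ∈ B, ∀ v ∈ B, G.Adj u v → O u = lo → O v = hi → (c u v, c v u) = ι w₀ → u = r
  have hex : ∃ (O : V → Finset (Fin 4)) (c : V → V → Fin 4), RespectsOn G O c Finset.univ ∧
      Inv Finset.univ O c ∧ RigidOn G c r Finset.univ := by
    refine exists_rigid_colouring hconn Inv (Finset.mem_insert_self r N) ?_ hresp hrig ?_ ?_ ?_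
    · intro x hx
      rcases Finset.mem_insert.1 hx with rfl | hx
      · exact ⟨w₀, Finset.mem_insert_of_mem hw₀, hrw⟩
      · exact ⟨r, Finset.mem_insert_self _ _, ((hN x).1 hx).symm⟩
    · refine ⟨subset_rfl, hcard, hOr, hOI w₀ hwI, Prod.ext (hc₀ w₀ hw₀).1 (hc₀ w₀ hw₀).2,
        fun x hx h1 h2 => ?_, fun u hu v hv huv h1 h2 _ => ?_⟩
      · rcases Finset.mem_insert.1 hx with rfl | hxN
        · exact (h1 hOr).elim
        · obtain ⟨y, hy, hxy⟩ := hImax x hxN fun hxI => h2 (hOI x hxI)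
          exact ⟨⟨r, Finset.mem_insert_self _ _, ((hN x).1 hxN).symm, hOr⟩,
            y, Finset.mem_insert_of_mem (hIN hy), hxy, hOI y hy⟩
      · by_contra hur
        have huN := Finset.mem_of_mem_insert_of_ne hu hur
        by_cases huI : u ∈ I
        · exact lo_ne_hi (by rw [← h1, hOI u huI])
        · exact (hOne u huN huI).1 h1
    · rintro T O c O' c' ⟨h1, h2, h3, h4, h5, h6, h7⟩ hO hc
      have hrT := h1 (Finset.mem_insert_self _ _)
      have hwT := h1 (Finset.mem_insert_of_mem hw₀)
      refine ⟨h1, fun x hx => by rw [hO x hx, h2 x hx], by rw [hO r hrT, h3],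
        by rw [hO w₀ hwT, h4], by rw [hc r hrT _ hwT, hc _ hwT r hrT, h5],
        fun x hx hx1 hx2 => ?_, fun u hu v hv huv hu1 hv1 huv' => ?_⟩
      · rw [hO x hx] at hx1 hx2
        obtain ⟨⟨y, hy, hxy, hyl⟩, z, hz, hxz, hzh⟩ := h6 x hx hx1 hx2
        exact ⟨⟨y, hy, hxy, by rw [hO y hy, hyl]⟩, z, hz, hxz, by rw [hO z hz, hzh]⟩
      · rw [hO u hu] at hu1
        rw [hO v hv] at hv1
        rw [hc u hu v hv, hc v hv u hu] at huv'
        exact h7 u hu v hv huv hu1 hv1 huv'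
    · rintro T B O c w - hTB - ⟨-, -, -, -, -, hT6, -⟩ ⟨h1, h2, h3, h4, h5, h6, h7⟩ hwB
        ⟨v, hvT, hwv⟩ htw hTn
      obtain ⟨y, hy, hvy⟩ := hTn v hvT
      have htwins := card_twins_le hΔ (s := {y}) hTB hwB hvT hwv htw (by simpa using hy)
        (by simpa using hvy)
      have hdeg := card_neighbors_add_le hΔ T B w
      have hYZ := Finset.card_filter_add_card_filter_not (s := B \ T) (G.Adj w)
      rw [Finset.card_singleton] at htwins
      have hmemB : ∀ x, x ∈ T.filter (G.Adj w) ∪ (B \ T).filter (G.Adj w) ↔ x ∈ B ∧ G.Adj w x := by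
        intro x
        rw [← Finset.filter_union, Finset.union_sdiff_of_subset hTB, Finset.mem_filter]
      obtain ⟨S, hS, hSO, hScr, v', hv', t, ht, htZ⟩ := exists_axisStep (l := ι w₀)
        (D := T.filter (G.Adj w)) (Y := (B \ T).filter (G.Adj w))
        (Z := (B \ T).filter fun z => ¬ G.Adj w z) (O := O) (lab := fun z x => (c z x, c x z))
        ⟨v, by simp [hvT, hwv]⟩ (fun x hx => h2 x ((hmemB x).1 hx).1) (by omega) hdeg
        (fun x hx hx1 hx2 => by
          obtain ⟨hxT, hwx⟩ := Finset.mem_filter.1 hx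
          obtain ⟨⟨y, hy, hxy, hyl⟩, z, hz, hxz, hzh⟩ := hT6 x hxT hx1 hx2
          have hyz : y ≠ z := fun e => lo_ne_hi (by rw [← hyl, ← hzh, e])
          have := card_twins_le hΔ (s := {y, z}) hTB hwB hxT hwx htw
            (by simp [Finset.insert_subset_iff, hy, hz]) (by simp [hxy, hxz])
          rw [Finset.card_pair hyz] at this
          omega)
      obtain ⟨hvT', hwv'⟩ := Finset.mem_filter.1 hv'
      have hlab : ∀ x ∈ B, G.Adj w x → ∃ s, s ∈ avoiding (ι w₀) S (O x) := fun x hx hwx =>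
        avoiding_nonempty (hS.trans (h2 x hx).symm) (hSO x ((hmemB x).2 ⟨hx, hwx⟩))
      choose! σ hσ using hlab
      obtain ⟨τ, hτ, hτv⟩ : ∃ τ : V → Fin 4 × Fin 4,
          (∀ x ∈ B, G.Adj w x → τ x ∈ avoiding (ι w₀) S (O x)) ∧ τ v' = t := by
        refine ⟨Function.update σ v' t, fun x hx hwx => ?_, by simp⟩
        by_cases h : x = v'
        · subst h; simpa using ht
        · simpa [h] using hσ x hx hwx
      have hne : ∀ x ∈ B, x ≠ w := fun x hx e => hwB (e ▸ hx)
      have hrB := h1 (Finset.mem_insert_self _ _)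
      have hwB' := h1 (Finset.mem_insert_of_mem hw₀)
      have hupd : ∀ x ∈ B, Function.update O w S x = O x := fun x hx => by simp [hne x hx]
      refine ⟨S, τ, fun x hx hwx => (mem_avoiding.1 (hτ x hx hwx)).1,
        fun z hz hzT hwz => ⟨v', hvT', hwv', ?_⟩, h1.trans (Finset.subset_insert _ _),
        fun x hx => ?_, by rw [hupd r hrB, h3], by rw [hupd w₀ hwB', h4], ?_,
        fun x hx hx1 hx2 => ?_, fun a ha b hb hab ha1 hb1 hab' => ?_⟩
      · rw [hτv]
        exact htZ z (by simp [hz, hzT, hwz])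
      · rcases Finset.mem_insert.1 hx with rfl | hxB
        · simpa using hS
        · rw [hupd x hxB, h2 x hxB]
      · rw [extendArcs_of_ne _ _ _ (hne r hrB) (hne w₀ hwB'),
          extendArcs_of_ne _ _ _ (hne w₀ hwB') (hne r hrB), h5]
      · rcases Finset.mem_insert.1 hx with rfl | hxB
        · rw [Function.update_self] at hx1 hx2
          obtain ⟨⟨y, hy, hyl⟩, z, hz, hzh⟩ := hScr hx1 hx2
          rw [hmemB] at hy hz
          exact ⟨⟨y, Finset.mem_insert_of_mem hy.1, hy.2, by rw [hupd y hy.1, hyl]⟩,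
            z, Finset.mem_insert_of_mem hz.1, hz.2, by rw [hupd z hz.1, hzh]⟩
        · rw [hupd x hxB] at hx1 hx2
          obtain ⟨⟨y, hy, hxy, hyl⟩, z, hz, hxz, hzh⟩ := h6 x hxB hx1 hx2
          exact ⟨⟨y, Finset.mem_insert_of_mem hy, hxy, by rw [hupd y hy, hyl]⟩,
            z, Finset.mem_insert_of_mem hz, hxz, by rw [hupd z hz, hzh]⟩
      · rcases Finset.mem_insert.1 ha with rfl | haB
        · have hbB := Finset.mem_of_mem_insert_of_ne hb hab.ne'
          rw [Function.update_self] at ha1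
          rw [hupd b hbB] at hb1
          rw [extendArcs_left, extendArcs_right _ _ _ (hne b hbB)] at hab'
          exact ((mem_avoiding.1 (hτ b hbB hab)).2.1 ha1 hb1 hab').elim
        · rw [hupd a haB] at ha1
          rcases Finset.mem_insert.1 hb with rfl | hbB
          · rw [Function.update_self] at hb1
            rw [extendArcs_left, extendArcs_right _ _ _ (hne a haB)] at hab'
            refine ((mem_avoiding.1 (hτ a haB hab.symm)).2.2 hb1 ha1 ?_).elim
            rw [← hab']; rfl
          · rw [hupd b hbB] at hb1
            rw [extendArcs_of_ne _ _ _ (hne a haB) (hne b hbB),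
              extendArcs_of_ne _ _ _ (hne b hbB) (hne a haB)] at hab'
            exact h7 a haB b hbB hab ha1 hb1 hab'
  obtain ⟨O, c, hR, ⟨-, -, hOr', hOw', hrwl, hcr, hl⟩, hrigid⟩ := hex
  refine ⟨c, hR.isTypeI (by simp), fun φ hφ => ?_⟩
  have hR' : ∀ u v, G.Adj u v → c u v ∈ O u ∧ c u v ∉ O v :=
    fun u v => hR u (by simp) v (by simp)
  have himg : ∀ x y, G.Adj (φ x) y → c (φ x) y ∈ O x := fun x y hxy => by
    obtain ⟨y, rfl⟩ := φ.surjective y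
    have hxy' := φ.map_adj_iff.1 hxy
    rw [hφ x y hxy']
    exact (hR' x y hxy').1
  have hφrw := φ.map_adj_iff.2 hrw
  have hu : O (φ r) = lo := by
    by_contra h
    by_cases h' : O (φ r) = hi
    · have h1 := (hR' _ _ hφrw).1
      have h2 := himg r _ hφrw
      rw [h'] at h1
      rw [hOr'] at h2
      exact notMem_hi_iff.2 h2 h1
    · obtain ⟨⟨y, -, hy, hyl⟩, -⟩ := hcr (φ r) (by simp) h h'
      exact (hR' _ _ hy).2 (by rw [hyl, ← hOr']; exact himg r y hy)
  have hw : O (φ w₀) = hi := by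
    by_contra h
    by_cases h' : O (φ w₀) = lo
    · have h1 := (hR' _ _ hφrw.symm).1
      have h2 := himg w₀ _ hφrw.symm
      rw [h'] at h1
      rw [hOw'] at h2
      exact notMem_hi_iff.2 h1 h2
    · obtain ⟨-, y, -, hy, hyh⟩ := hcr (φ w₀) (by simp) h' h
      exact (hR' _ _ hy).2 (by rw [hyh, ← hOw']; exact himg w₀ y hy)
  have hr : φ r = r := hl (φ r) (by simp) (φ w₀) (by simp) hφrw hu hw
    (by rw [hφ r w₀ hrw, hφ w₀ r hrw.symm, hrwl])
  exact fun x => hrigid c (fun _ _ _ _ _ => rfl) (hR.isTypeI (by simp)) φ hφ hr x (by simp)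

end FourColours

section ThreeColours

variable {V : Type*} [DecidableEq V] {G : SimpleGraph V}

lemma apply_eq_self_of_adj
    (hΔ : ∀ x (s : Finset V), (∀ y ∈ s, G.Adj x y) → s.card ≤ 2) (φ : G ≃g G) {v a y : V}
    (hv : φ v = v) (hva : G.Adj v a) (ha : φ a = a) (hvy : G.Adj v y) : φ y = y := by
  by_contra h
  have hya : y ≠ a := fun e => h (e ▸ ha)
  have hφya : φ y ≠ a := fun e => hya (φ.injective (e.trans ha.symm))
  have hφy : G.Adj v (φ y) := by simpa [hv] using φ.map_adj_iff.2 hvy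
  have h3 : ({a, y, φ y} : Finset V).card = 3 :=
    Finset.card_eq_three.2 ⟨a, y, φ y, hya.symm, hφya.symm, Ne.symm h, rfl⟩
  have := hΔ v {a, y, φ y} (by
    intro z hz
    simp only [Finset.mem_insert, Finset.mem_singleton] at hz
    rcases hz with rfl | rfl | rfl <;> assumption)
  omega

lemma eq_self_of_fixes_edge (hconn : G.Connected)
    (hΔ : ∀ x (s : Finset V), (∀ y ∈ s, G.Adj x y) → s.card ≤ 2) (φ : G ≃g G) {r a : V}
    (hr : φ r = r) (hra : G.Adj r a) (ha : φ a = a) (x : V) : φ x = x := by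
  suffices h : ∀ {v x : V}, G.Walk v x → φ v = v → (∀ y, G.Adj v y → φ y = y) → φ x = x from
    h (hconn.preconnected r x).some hr fun y => apply_eq_self_of_adj hΔ φ hr hra ha
  intro v x p
  induction p with
  | nil => exact fun h _ => h
  | cons hadj _ ih =>
    intro hv hy
    exact ih (hy _ hadj) fun y => apply_eq_self_of_adj hΔ φ (hy _ hadj) hadj.symm hv

lemma exists_colouring_of_bipartite (hconn : G.Connected)
    (hΔ : ∀ x (s : Finset V), (∀ y ∈ s, G.Adj x y) → s.card ≤ 2) {f : V → Fin 2}
    (hf : ∀ x y, G.Adj x y → f x ≠ f y) {r w : V} (hrw : G.Adj r w) (hr : f r = 1) :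
    ∃ c : V → V → Fin 3, IsTypeIColouring G c ∧ IsDistinguishing G c := by
  refine ⟨fun x y => if f x = 0 then 0 else if x = r ∧ y = w then 2 else 1, ?_, ?_⟩
  · intro x y z hxy _
    have := hf x y hxy
    dsimp only
    split_ifs <;> first | decide | omega
  · intro φ hφ
    have h := hφ r w hrw
    simp only [hr, one_ne_zero, if_false, and_self, if_true] at h
    split_ifs at h with _ h2
    · exact absurd h (by decide)
    · exact eq_self_of_fixes_edge hconn hΔ φ h2.1 hrw h2.2
    · exact absurd h (by decide)

lemma exists_almost_two_colouring [Fintype V] (hconn : G.Connected)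
    (hΔ : ∀ x (s : Finset V), (∀ y ∈ s, G.Adj x y) → s.card ≤ 2) :
    ∃ f : V → Fin 2, ∀ x y x' y', G.Adj x y → G.Adj x' y' → f x = f y → f x' = f y' →
      s(x, y) = s(x', y') := by
  classical
  obtain ⟨T, hTG, hT⟩ := hconn.exists_isTree_le
  refine ⟨hT.coloringTwo, fun x y x' y' hxy hxy' h h' => ?_⟩
  have hdeg : ∑ v, G.degree v ≤ ∑ _v : V, 2 := Finset.sum_le_sum fun v _ =>
    hΔ v (G.neighborFinset v) fun y => (G.mem_neighborFinset v y).1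
  rw [G.sum_degrees_eq_twice_card_edges, Finset.sum_const, Finset.card_univ, smul_eq_mul] at hdeg
  have hTcard := hT.card_edgeFinset
  have hsub : T.edgeFinset ⊆ G.edgeFinset := SimpleGraph.edgeFinset_mono hTG
  have hcard := Finset.card_sdiff_add_card_eq_card hsub
  have hmono : ∀ a b, G.Adj a b → hT.coloringTwo a = hT.coloringTwo b →
      s(a, b) ∈ G.edgeFinset \ T.edgeFinset := fun a b hab e => by
    rw [Finset.mem_sdiff, SimpleGraph.mem_edgeFinset, SimpleGraph.mem_edgeFinset]
    exact ⟨hab, fun hT' => hT.coloringTwo.valid hT' e⟩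
  exact Finset.card_le_one.1 (by omega) _ (hmono x y hxy h) _ (hmono x' y' hxy' h')

/-- Three colours suffice for paths and cycles. -/
theorem exists_colouring_of_three [Fintype V] (hconn : G.Connected)
    (hΔ : ∀ x (s : Finset V), (∀ y ∈ s, G.Adj x y) → s.card ≤ 2) {a b : V} (hab : G.Adj a b) :
    ∃ c : V → V → Fin 3, IsTypeIColouring G c ∧ IsDistinguishing G c := by
  obtain ⟨f, hf⟩ := exists_almost_two_colouring hconn hΔ
  by_cases hbip : ∀ x y, G.Adj x y → f x ≠ f y
  · by_cases ha : f a = 1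
    · exact exists_colouring_of_bipartite hconn hΔ hbip hab ha
    · exact exists_colouring_of_bipartite hconn hΔ hbip hab.symm
        (by have := hbip a b hab; omega)
  push Not at hbip
  obtain ⟨u, w, huw, hfuw⟩ := hbip
  have hlast : ∀ x, (if x = u then Fin.last 2 else (f x).castSucc) = Fin.last 2 → x = u :=
    fun x hx => by
      split_ifs at hx with h
      · exact h
      · exact absurd hx (Fin.castSucc_lt_last _).ne
  refine ⟨fun x _ => if x = u then Fin.last 2 else (f x).castSucc, ?_, ?_⟩
  · intro x y z hxy _ h
    dsimp only at h
    by_cases hx : x = u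
    · rw [if_pos hx] at h
      exact hxy.ne (hx.trans (hlast y h.symm).symm)
    · by_cases hy : y = u
      · rw [if_pos hy] at h
        exact hx (hlast x h)
      · rw [if_neg hx, if_neg hy, Fin.castSucc_inj] at h
        have hu : u ∈ s(x, y) := hf u w x y huw hxy hfuw h ▸ Sym2.mem_mk_left u w
        rcases Sym2.mem_iff.1 hu with rfl | rfl
        · exact hx rfl
        · exact hy rfl
  · intro φ hφ
    have hu : φ u = u := hlast _ (by simpa using hφ u w huw)
    have hw := hφ w u huw.symm
    have hadj : G.Adj u (φ w) := by simpa [hu] using φ.map_adj_iff.2 huw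
    dsimp only at hw
    rw [if_neg hadj.ne.symm, if_neg huw.ne.symm, Fin.castSucc_inj] at hw
    have hs := hf u (φ w) u w hadj huw (hfuw.trans hw.symm) hfuw
    exact eq_self_of_fixes_edge hconn hΔ φ hu huw (Sym2.congr_right.1 hs)

end ThreeColours

end ArcColouring

theorem stmt7 {V : Type*} [Fintype V] [DecidableEq V]
    (G : SimpleGraph V) [DecidableRel G.Adj]
    (hconn : G.Connected) (hedge : ∃ u v : V, G.Adj u v) :
    ∃ c : V → V → Fin ⌈2 * Real.sqrt (G.maxDegree : ℝ)⌉₊,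
      IsTypeIColouring G c ∧ IsDistinguishing G c := by
  obtain ⟨a, b, hab⟩ := hedge
  have hdeg : ∀ x (s : Finset V), (∀ y ∈ s, G.Adj x y) → s.card ≤ G.maxDegree := fun x s hs =>
    (Finset.card_le_card fun y hy => (G.mem_neighborFinset x y).2 (hs y hy)).trans
      (G.degree_le_maxDegree x)
  have : Nonempty V := ⟨a⟩
  obtain ⟨r, hr⟩ := G.exists_maximal_degree_vertex
  have hpos : 1 ≤ G.maxDegree := by simpa using hdeg a {b} (by simpa using hab)
  have hle := Nat.le_ceil (2 * Real.sqrt (G.maxDegree : ℝ))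
  have hlt := Nat.ceil_lt_add_one (a := 2 * Real.sqrt (G.maxDegree : ℝ)) (by positivity)
  generalize ⌈2 * Real.sqrt (G.maxDegree : ℝ)⌉₊ = k at hle hlt ⊢
  replace hr := hr.symm
  generalize G.maxDegree = Δ at hdeg hr hpos hle hlt
  have hsq := Real.sq_sqrt (Nat.cast_nonneg (α := ℝ) Δ)
  have hs0 : 1 ≤ Real.sqrt (Δ : ℝ) := Real.one_le_sqrt.2 (by exact_mod_cast hpos)
  have hk4 : 4 * Δ ≤ k * k := by
    have : (4 * Δ : ℝ) ≤ k * k := by nlinarith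
    exact_mod_cast this
  have hk2 : k < 2 * Δ + 1 := by
    have : (k : ℝ) < 2 * Δ + 1 := by nlinarith
    exact_mod_cast this
  have h2k : 2 ≤ k := by nlinarith
  have hprod : Δ ≤ k / 2 * (k - k / 2) := by
    obtain ⟨m, rfl | rfl⟩ := Nat.even_or_odd' k
    · rw [show 2 * m / 2 = m by omega, show 2 * m - m = m by omega]
      nlinarith
    · rw [show (2 * m + 1) / 2 = m by omega, show 2 * m + 1 - m = m + 1 by omega]
      have h : (2 * m + 1) * (2 * m + 1) = 4 * (m * (m + 1)) + 1 := by ring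
      omega
  by_cases h : Δ ≤ 1 ∨ 5 ≤ k
  · exact ArcColouring.exists_colouring_of_exchange hconn hdeg
      (fun x => G.mem_neighborFinset r x) hr hpos h2k h hprod (by omega)
  · obtain rfl | rfl | rfl : k = 2 ∨ k = 3 ∨ k = 4 := by omega
    · omega
    · exact ArcColouring.exists_colouring_of_three hconn
        (fun x s hs => (hdeg x s hs).trans (by omega)) hab
    · exact ArcColouring.exists_colouring_of_four hconn
        (fun x s hs => (hdeg x s hs).trans (by omega)) hab
end

section
/- For every Δ ≥ 1, the least number of colours in a distinguishing proper arc-colouring of type I of the symmetric directed star ↔K_{1,Δ} equals ⌈2√Δ⌉. -/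
/-- The automorphism of a complete bipartite graph induced by a permutation of its second part. -/
def completeBipartiteGraphCongrRight (V : Type*) {W : Type*} (e : Equiv.Perm W) :
    completeBipartiteGraph V W ≃g completeBipartiteGraph V W where
  toEquiv := Equiv.sumCongr (Equiv.refl V) e
  map_rel_iff' := by
    rintro (a | a) (b | b) <;> simp [completeBipartiteGraph]

/-- In a distinguishing arc-colouring of a star, no two leaves carry the same pair of colours. -/
theorem IsDistinguishing.injective_star {Δ m : ℕ} {c : (Fin 1 ⊕ Fin Δ) → (Fin 1 ⊕ Fin Δ) → Fin m}
    (hc : IsDistinguishing (completeBipartiteGraph (Fin 1) (Fin Δ)) c) :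
    Function.Injective fun i : Fin Δ => (c (.inr i) (.inl 0), c (.inl 0) (.inr i)) := by
  intro i j hij
  simp only [Prod.mk.injEq] at hij
  have key : ∀ x, c (.inr (Equiv.swap i j x)) (.inl 0) = c (.inr x) (.inl 0) ∧
      c (.inl 0) (.inr (Equiv.swap i j x)) = c (.inl 0) (.inr x) := by
    intro x
    rw [Equiv.swap_apply_def]
    split_ifs with h h'
    · subst h; exact ⟨hij.1.symm, hij.2.symm⟩
    · subst h'; exact hij
    · exact ⟨rfl, rfl⟩
  have h := hc (completeBipartiteGraphCongrRight (Fin 1) (Equiv.swap i j)) (by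
    rintro (a | a) (b | b) hab
    · simp at hab
    · obtain rfl := Subsingleton.elim a 0
      exact (key b).2
    · obtain rfl := Subsingleton.elim b 0
      exact (key a).1
    · simp at hab) (.inr i)
  have h' : Equiv.swap i j i = i := Sum.inr_injective h
  rw [Equiv.swap_apply_left] at h'
  exact h'.symm

/-- The colours entering and leaving the centre of the star are disjoint, which bounds
the number of leaves. -/
theorem four_mul_le_sq_of_star_colouring {Δ m : ℕ}
    {c : (Fin 1 ⊕ Fin Δ) → (Fin 1 ⊕ Fin Δ) → Fin m}
    (h₁ : IsTypeIColouring (completeBipartiteGraph (Fin 1) (Fin Δ)) c)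
    (h₂ : IsDistinguishing (completeBipartiteGraph (Fin 1) (Fin Δ)) c) :
    4 * Δ ≤ m ^ 2 := by
  set A : Finset (Fin m) := Finset.univ.image fun i : Fin Δ => c (.inr i) (.inl 0) with hA
  set B : Finset (Fin m) := Finset.univ.image fun i : Fin Δ => c (.inl 0) (.inr i) with hB
  have hdisj : Disjoint A B := by
    rw [Finset.disjoint_left]
    intro x hxA hxB
    obtain ⟨i, -, rfl⟩ := Finset.mem_image.1 hxA
    obtain ⟨j, -, hj⟩ := Finset.mem_image.1 hxB
    exact h₁ (.inr i) (.inl 0) (.inr j) (by simp) (by simp) hj.symm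
  have hsum : A.card + B.card ≤ m := by
    rw [← Finset.card_union_of_disjoint hdisj]
    simpa using Finset.card_le_univ (A ∪ B)
  have hprod : Δ ≤ A.card * B.card := by
    rw [← Finset.card_product]
    simpa using Finset.card_le_card_of_injOn (s := Finset.univ) (t := A ×ˢ B)
      (fun i : Fin Δ => (c (.inr i) (.inl 0), c (.inl 0) (.inr i)))
      (fun i _ => by simp [hA, hB]) h₂.injective_star.injOn
  nlinarith [four_mul_le_sq_add A.card B.card, Nat.pow_le_pow_left hsum 2]

/-- Disjoint sets of about `m / 2` colours for the arcs entering and leaving the centre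
suffice whenever `4 * Δ ≤ m ^ 2`. -/
theorem exists_star_colouring {Δ m : ℕ} (hΔ : 1 ≤ Δ) (hm : 4 * Δ ≤ m ^ 2) :
    ∃ c : (Fin 1 ⊕ Fin Δ) → (Fin 1 ⊕ Fin Δ) → Fin m,
      IsTypeIColouring (completeBipartiteGraph (Fin 1) (Fin Δ)) c ∧
      IsDistinguishing (completeBipartiteGraph (Fin 1) (Fin Δ)) c := by
  obtain ⟨a, b, rfl, hab⟩ : ∃ a b, m = a + b ∧ Δ ≤ a * b := by
    obtain ⟨k, rfl | rfl⟩ := Nat.even_or_odd' m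
    · exact ⟨k, k, by ring, by nlinarith⟩
    · refine ⟨k, k + 1, by ring, ?_⟩
      have : 4 * Δ ≤ 4 * (k * (k + 1)) + 1 := by linarith
      omega
  obtain ⟨f⟩ : Nonempty (Fin Δ ↪ Fin a × Fin b) :=
    Function.Embedding.nonempty_of_card_le (by simpa using hab)
  let i₀ : Fin Δ := ⟨0, hΔ⟩
  let c : (Fin 1 ⊕ Fin Δ) → (Fin 1 ⊕ Fin Δ) → Fin (a + b)
    | .inr i, _ => Fin.castAdd b (f i).1
    | .inl _, .inr i => Fin.natAdd a (f i).2
    | .inl _, .inl _ => Fin.castAdd b (f i₀).1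
  have hne : ∀ i j, Fin.castAdd b (f i).1 ≠ Fin.natAdd a (f j).2 := by
    intro i j h
    have := congrArg Fin.val h
    simp only [Fin.val_castAdd, Fin.val_natAdd] at this
    omega
  refine ⟨c, ?_, ?_⟩
  · rintro (u | u) (v | v) (w | w) huv hvw <;> simp at huv hvw
    · exact (hne _ _).symm
    · exact hne _ _
  · intro φ hφ
    have hadj : ∀ i, (completeBipartiteGraph (Fin 1) (Fin Δ)).Adj (φ (.inl 0)) (φ (.inr i)) :=
      fun i => φ.map_adj_iff.2 (by simp)
    have hout := fun i => hφ (.inl 0) (.inr i) (by simp)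
    have hin := fun i => hφ (.inr i) (.inl 0) (by simp)
    rcases h0 : φ (.inl 0) with z | j
    · rintro (x | i)
      · rw [Subsingleton.elim x 0, h0, Subsingleton.elim z 0]
      · have h1 := hadj i
        have h2 := hout i
        have h3 := hin i
        rw [h0] at h1 h2 h3
        rcases hi : φ (.inr i) with y | j
        · simp [hi] at h1
        · rw [hi] at h2 h3
          exact congrArg Sum.inr (f.injective (Prod.ext (Fin.castAdd_injective _ _ h3)
            (Fin.natAdd_injective _ _ h2)))
    · have h2 := hout i₀
      rw [h0] at h2
      exact absurd h2 (hne _ _)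

theorem stmt8 (Δ : ℕ) (hΔ : 1 ≤ Δ) :
    sInf {m : ℕ | ∃ c : (Fin 1 ⊕ Fin Δ) → (Fin 1 ⊕ Fin Δ) → Fin m,
        IsTypeIColouring (completeBipartiteGraph (Fin 1) (Fin Δ)) c ∧
        IsDistinguishing (completeBipartiteGraph (Fin 1) (Fin Δ)) c} =
    ⌈2 * Real.sqrt (Δ : ℝ)⌉₊ := by
  rw [← csInf_Ici (a := ⌈2 * Real.sqrt (Δ : ℝ)⌉₊)]
  congr 1
  ext m
  have hceil : ⌈2 * Real.sqrt (Δ : ℝ)⌉₊ ≤ m ↔ 4 * Δ ≤ m ^ 2 := by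
    rw [Nat.ceil_le, ← sq_le_sq₀ (by positivity) (by positivity), mul_pow, Real.sq_sqrt (by positivity)]
    norm_num
    exact_mod_cast Iff.rfl
  rw [Set.mem_Ici, hceil]
  exact ⟨fun ⟨_, h₁, h₂⟩ => four_mul_le_sq_of_star_colouring h₁ h₂, exists_star_colouring hΔ⟩
end

section
/- Let G be a connected bipartite simple graph on a finite vertex set with at least 3 vertices. Then the least number of colours in an arc-colouring of the symmetric digraph ↔G with no monochromatic 2-path equals the least number of colours in a proper arc-colouring of type I of ↔G (and both equal 2). -/
theorem IsTypeIColouring.noMono2Path {V : Type*} {G : SimpleGraph V} {k : ℕ}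
    {c : V → V → Fin k} (hc : IsTypeIColouring G c) : NoMono2Path G c :=
  fun u v w huv hvw _ => hc u v w huv hvw

/-- Colouring every arc by the colour of its tail turns a proper vertex colouring into a
type-I proper arc-colouring. -/
theorem SimpleGraph.Coloring.isTypeIColouring {V : Type*} {G : SimpleGraph V} {k : ℕ}
    (C : G.Coloring (Fin k)) : IsTypeIColouring G fun u _ => C u :=
  fun _ _ _ huv _ => C.valid huv

/-- In a connected graph, every nonempty proper set of vertices is left by some edge. -/
theorem SimpleGraph.Connected.exists_adj_mem_notMem {V : Type*} {G : SimpleGraph V}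
    (hconn : G.Connected) {S : Set V} {a x : V} (ha : a ∈ S) (hx : x ∉ S) :
    ∃ u ∈ S, ∃ v ∉ S, G.Adj u v := by
  obtain ⟨p⟩ := hconn.preconnected a x
  obtain ⟨d, -, hd, hd'⟩ := p.exists_boundary_dart S ha hx
  exact ⟨d.fst, hd, d.snd, hd', d.adj⟩

/-- A connected graph with at least three vertices contains a path of length two. -/
theorem SimpleGraph.Connected.exists_two_path {V : Type*} [Fintype V] {G : SimpleGraph V}
    (hconn : G.Connected) (hcard : 3 ≤ Fintype.card V) :
    ∃ u v w, G.Adj u v ∧ G.Adj v w ∧ w ≠ u := by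
  obtain ⟨a, x, y, hax, hay, hxy⟩ := Fintype.two_lt_card_iff.mp hcard
  obtain ⟨_, ha, b, -, hab⟩ :=
    hconn.exists_adj_mem_notMem (Set.mem_singleton a) (x := x) (Ne.symm hax)
  obtain rfl := Set.eq_of_mem_singleton ha.symm
  obtain ⟨z, hz⟩ : ∃ z, z ∉ ({a, b} : Set V) := by
    by_cases hb : x = b
    · exact ⟨y, by grind⟩
    · exact ⟨x, by grind⟩
  obtain ⟨u, hu, w, hw, huw⟩ := hconn.exists_adj_mem_notMem (Set.mem_insert a {b}) hz
  simp only [Set.mem_insert_iff, Set.mem_singleton_iff, not_or] at hu hw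
  rcases hu with rfl | rfl
  · exact ⟨b, u, w, hab.symm, huw, hw.2⟩
  · exact ⟨a, u, w, hab, huw, hw.1⟩

theorem NoMono2Path.two_le {V : Type*} [Fintype V] {G : SimpleGraph V} {k : ℕ}
    {c : V → V → Fin k} (hc : NoMono2Path G c) (hconn : G.Connected)
    (hcard : 3 ≤ Fintype.card V) : 2 ≤ k := by
  obtain ⟨u, v, w, huv, hvw, hwu⟩ := hconn.exists_two_path hcard
  have : Nontrivial (Fin k) := ⟨_, _, hc u v w huv hvw hwu⟩
  exact Fin.nontrivial_iff_two_le.mp this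

theorem stmt10 {V : Type*} [Fintype V] (G : SimpleGraph V)
    (hconn : G.Connected) (hbip : G.Colorable 2) (hcard : 3 ≤ Fintype.card V) :
    sInf {k : ℕ | ∃ c : V → V → Fin k, NoMono2Path G c} =
      sInf {k : ℕ | ∃ c : V → V → Fin k, IsTypeIColouring G c} ∧
    sInf {k : ℕ | ∃ c : V → V → Fin k, IsTypeIColouring G c} = 2 := by
  obtain ⟨C⟩ := hbip
  have hC := C.isTypeIColouring
  have hpath : IsLeast {k : ℕ | ∃ c : V → V → Fin k, NoMono2Path G c} 2 :=
    ⟨⟨_, hC.noMono2Path⟩, fun _ ⟨_, hc⟩ => hc.two_le hconn hcard⟩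
  have htype : IsLeast {k : ℕ | ∃ c : V → V → Fin k, IsTypeIColouring G c} 2 :=
    ⟨⟨_, hC⟩, fun _ ⟨_, hc⟩ => hc.noMono2Path.two_le hconn hcard⟩
  exact ⟨hpath.csInf_eq.trans htype.csInf_eq.symm, htype.csInf_eq⟩
end

section
/- For every n ≥ 2, the least number of colours in an arc-colouring of the complete symmetric digraph ↔K_n with no monochromatic 2-path is at most 1 plus the least number of colours in a proper arc-colouring of type I of the complete symmetric digraph ↔K_{⌈n/2⌉}. -/
/-- Colouring every ordered pair with its own colour is a type-I proper arc-colouring. -/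
theorem isTypeIColouring_finProdFinEquiv {m : ℕ} (G : SimpleGraph (Fin m)) :
    IsTypeIColouring G fun u v => finProdFinEquiv (u, v) := by
  intro u v w huv _ h
  exact huv.ne (Prod.ext_iff.mp (finProdFinEquiv.injective h)).1

/-- Given a map `f` with fibres of size at most two, a type-I proper arc-colouring of the complete
digraph on the codomain pulls back to an arc-colouring of the complete digraph on the domain without
monochromatic 2-path, using one extra colour for the arcs inside the fibres. -/
theorem IsTypeIColouring.noMono2Path_pullback {V W : Type*} [DecidableEq W] {k : ℕ}
    {c : W → W → Fin k} (hc : IsTypeIColouring (⊤ : SimpleGraph W) c) (f : V → W)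
    (hf : ∀ u v w, f u = f v → f v = f w → u ≠ v → v ≠ w → w = u) :
    NoMono2Path (⊤ : SimpleGraph V)
      fun u v => if f u = f v then Fin.last k else (c (f u) (f v)).castSucc := by
  intro u v w huv hvw hwu
  rw [SimpleGraph.top_adj] at huv hvw
  by_cases h₁ : f u = f v <;> by_cases h₂ : f v = f w
  · exact absurd (hf u v w h₁ h₂ huv hvw) hwu
  · simpa [h₁, h₂] using (Fin.castSucc_ne_last _).symm
  · simp [h₁, ← h₂]
  · simpa [h₁, h₂] using hc (f u) (f v) (f w) h₁ h₂

theorem stmt11 (n : ℕ) (hn : 2 ≤ n) :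
    sInf {k : ℕ | ∃ c : Fin n → Fin n → Fin k,
        NoMono2Path (⊤ : SimpleGraph (Fin n)) c} ≤
    1 + sInf {k : ℕ | ∃ c : Fin ((n + 1) / 2) → Fin ((n + 1) / 2) → Fin k,
        IsTypeIColouring (⊤ : SimpleGraph (Fin ((n + 1) / 2))) c} := by
  obtain ⟨c, hc⟩ := Nat.sInf_mem (s := {k : ℕ |
    ∃ c : Fin ((n + 1) / 2) → Fin ((n + 1) / 2) → Fin k,
      IsTypeIColouring (⊤ : SimpleGraph (Fin ((n + 1) / 2))) c})
    ⟨_, _, isTypeIColouring_finProdFinEquiv ⊤⟩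
  rw [add_comm]
  refine Nat.sInf_le ⟨_, hc.noMono2Path_pullback (fun x : Fin n => ⟨x / 2, by omega⟩) ?_⟩
  intro u v w h₁ h₂ huv hvw
  simp only [Fin.mk.injEq] at h₁ h₂
  omega
end

section
/- Let l ≥ 2 be an integer and let n = C(2l+1, l) + 1. Then the least number of colours in an arc-colouring of the complete symmetric digraph ↔K_n with no monochromatic 2-path is strictly less than the least number of colours in a proper arc-colouring of type I of ↔K_n; in particular ↔K_n admits an arc-colouring with 2l+1 colours having no monochromatic 2-path, while every proper arc-colouring of type I of ↔K_n uses at least 2l+2 colours. -/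
/-- The out-colour sets of a type-I proper colouring of a complete digraph form an antichain,
so Sperner's theorem bounds the number of vertices. -/
theorem IsTypeIColouring.card_le_choose {V : Type*} [Fintype V] [DecidableEq V] {k : ℕ}
    {c : V → V → Fin k} (hc : IsTypeIColouring (⊤ : SimpleGraph V) c) :
    Fintype.card V ≤ k.choose (k / 2) := by
  let S : V → Finset (Fin k) := fun u => (Finset.univ.erase u).image (c u)
  have hS : ∀ u v, u ≠ v → ¬ S u ⊆ S v := by
    intro u v huv hsub
    have hmem : c u v ∈ S u := Finset.mem_image_of_mem _ (by simp [huv.symm])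
    obtain ⟨w, hw, hvw⟩ := Finset.mem_image.1 (hsub hmem)
    exact hc u v w (by simpa using huv) (by simpa using (Finset.ne_of_mem_erase hw).symm) hvw.symm
  have hinj : Function.Injective S := fun u v huv => by
    by_contra hne
    exact hS u v hne huv.subset
  have hanti : IsAntichain (· ⊆ ·) (Finset.univ.image S : Set (Finset (Fin k))) := by
    intro A hA B hB hAB
    simp only [Finset.coe_image, Finset.coe_univ, Set.image_univ, Set.mem_range] at hA hB
    obtain ⟨u, rfl⟩ := hA
    obtain ⟨v, rfl⟩ := hB
    exact hS u v fun h => hAB (congrArg S h)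
  simpa [Finset.card_image_of_injective _ hinj] using hanti.sperner

theorem exists_isTypeIColouring {n : ℕ} (G : SimpleGraph (Fin n)) :
    ∃ (k : ℕ) (c : Fin n → Fin n → Fin k), IsTypeIColouring G c := by
  refine ⟨n * n, fun u v => finProdFinEquiv (u, v), fun u v w huv _ h => huv.ne ?_⟩
  exact (Prod.ext_iff.1 (finProdFinEquiv.injective h)).1

/-- Take two copies of each `r`-subset of `Fin m` as vertices: an arc between distinct sets `A`,
`B` gets a colour from `A \ B`, and the two copies of a set are joined by an extra colour. -/
theorem exists_noMono2Path_of_card_le {V : Type*} [Fintype V] {m r : ℕ}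
    (hV : Fintype.card V ≤ 2 * m.choose r) :
    ∃ c : V → V → Fin (m + 1), NoMono2Path (⊤ : SimpleGraph V) c := by
  obtain ⟨f⟩ : Nonempty (V ↪ Finset.powersetCard r (Finset.univ : Finset (Fin m)) × Bool) :=
    Function.Embedding.nonempty_of_card_le (by simpa [mul_comm] using hV)
  have hex : ∀ A B : Finset.powersetCard r (Finset.univ : Finset (Fin m)), A ≠ B →
      ∃ i, i ∈ A.1 ∧ i ∉ B.1 := by
    intro A B hAB
    refine Finset.not_subset.1 fun hsub => hAB (Subtype.ext (Finset.eq_of_subset_of_card_le hsub ?_))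
    rw [(Finset.mem_powersetCard.1 A.2).2, (Finset.mem_powersetCard.1 B.2).2]
  choose g hgA hgB using hex
  refine ⟨fun u v => if h : (f u).1 = (f v).1 then Fin.last m else (g _ _ h).castSucc, ?_⟩
  intro u v w huv hvw hwu
  have hfuv : f u ≠ f v := f.injective.ne huv.ne
  have hfvw : f v ≠ f w := f.injective.ne hvw.ne
  have hfwu : f w ≠ f u := f.injective.ne hwu
  by_cases h₁ : (f u).1 = (f v).1 <;> by_cases h₂ : (f v).1 = (f w).1
  · have hb : ∀ a b c : Bool, a ≠ b → b ≠ c → c = a := by decide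
    exact absurd (Prod.ext (h₂.symm.trans h₁.symm)
      (hb _ _ _ (fun h => hfuv (Prod.ext h₁ h)) fun h => hfvw (Prod.ext h₂ h))) hfwu
  · simp only [dif_pos h₁, dif_neg h₂]
    exact (Fin.castSucc_lt_last _).ne'
  · simp only [dif_neg h₁, dif_pos h₂]
    exact (Fin.castSucc_lt_last _).ne
  · simp only [h₁, h₂, dite_false, ne_eq, Fin.castSucc_inj]
    exact fun h => hgB _ _ h₁ (h ▸ hgA _ _ h₂)

theorem choose_two_mul_add_one_lt {l : ℕ} (hl : l ≠ 0) :
    (2 * l + 1).choose l < 2 * (2 * l).choose l := by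
  obtain ⟨m, rfl⟩ := Nat.exists_eq_succ_of_ne_zero hl
  have hrec := Nat.choose_succ_right_eq (2 * (m + 1)) m
  have hpos : 0 < (2 * (m + 1)).choose m := Nat.choose_pos (by lia)
  rw [show 2 * (m + 1) - m = m + 2 by lia] at hrec
  rw [Nat.succ_eq_add_one, Nat.choose_succ_succ']
  nlinarith

theorem stmt13 (l : ℕ) (hl : 2 ≤ l) (n : ℕ) (hn : n = (2 * l + 1).choose l + 1) :
    sInf {k : ℕ | ∃ c : Fin n → Fin n → Fin k,
        NoMono2Path (⊤ : SimpleGraph (Fin n)) c} <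
      sInf {k : ℕ | ∃ c : Fin n → Fin n → Fin k,
        IsTypeIColouring (⊤ : SimpleGraph (Fin n)) c} ∧
    (∃ c : Fin n → Fin n → Fin (2 * l + 1),
        NoMono2Path (⊤ : SimpleGraph (Fin n)) c) ∧
    (∀ (k : ℕ) (c : Fin n → Fin n → Fin k),
        IsTypeIColouring (⊤ : SimpleGraph (Fin n)) c → 2 * l + 2 ≤ k) := by
  have hupper : ∃ c : Fin n → Fin n → Fin (2 * l + 1),
      NoMono2Path (⊤ : SimpleGraph (Fin n)) c := by
    apply exists_noMono2Path_of_card_le (r := l)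
    have := choose_two_mul_add_one_lt (l := l) (by lia)
    rw [Fintype.card_fin]
    lia
  have hlower : ∀ (k : ℕ) (c : Fin n → Fin n → Fin k),
      IsTypeIColouring (⊤ : SimpleGraph (Fin n)) c → 2 * l + 2 ≤ k := by
    intro k c hc
    by_contra! hk
    have hcard := hc.card_le_choose
    have hmono : k.choose (k / 2) ≤ (2 * l + 1).choose (k / 2) :=
      Nat.choose_le_choose _ (by lia)
    have hmiddle := Nat.choose_le_middle (k / 2) (2 * l + 1)
    rw [show (2 * l + 1) / 2 = l by lia] at hmiddle
    rw [Fintype.card_fin] at hcard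
    lia
  refine ⟨?_, hupper, hlower⟩
  obtain ⟨c, hc⟩ := Nat.sInf_mem (exists_isTypeIColouring (⊤ : SimpleGraph (Fin n)))
  exact (Nat.sInf_le hupper).trans_lt (hlower _ c hc)
end
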